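/- Let ν > 0. Then the positive zeros of J_ν′ and J_{ν+2}′ are interlaced on (0,∞), and the positive zeros of Y_ν′ and Y_{ν+2}′ are interlaced on (0,∞), where primes denote derivatives with respect to x. -/

import Mathlib

open Real Filter Topology Set

/-- Bessel function of the first kind of real order `ν`:
`J_ν(x) = ∑ ((−1)^m / (m! Γ(m+ν+1))) (x/2)^{2m+ν}` (with `1/Γ = 0` at nonpositive
integers, which agrees with Lean's `1/0 = 0` since `Real.Gamma` vanishes there). -/
noncomputable def besselJ (ν : ℝ) (x : ℝ) : ℝ :=
  ∑' m : ℕ, ((-1 : ℝ) ^ m / (m.factorial * Real.Gamma ((m : ℝ) + ν + 1))) *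
    (x / 2) ^ (2 * (m : ℝ) + ν)

/-- Bessel function of the second kind, characterized as the limit
`(J_μ(x) cos(μπ) − J_{−μ}(x)) / sin(μπ) → Y_ν(x)` as `μ → ν` through non-integer reals. -/
noncomputable def besselY (ν : ℝ) (x : ℝ) : ℝ :=
  limUnder (𝓝[{μ : ℝ | ∀ n : ℤ, μ ≠ (n : ℝ)}] ν)
    (fun μ : ℝ => (besselJ μ x * Real.cos (μ * π) - besselJ (-μ) x) / Real.sin (μ * π))

/-- The cylinder function `C_ν(x) = cos δ · J_ν(x) − sin δ · Y_ν(x)`. -/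
noncomputable def cylinder (δ ν : ℝ) (x : ℝ) : ℝ :=
  Real.cos δ * besselJ ν x - Real.sin δ * besselY ν x

/-- One direction of the interlacing property: between any two consecutive zeros of `f`
in `I` there is exactly one zero of `g`. -/
def InterlaceHalf (f g : ℝ → ℝ) (I : Set ℝ) : Prop :=
  ∀ x₁ ∈ I, ∀ x₂ ∈ I, x₁ < x₂ → f x₁ = 0 → f x₂ = 0 →
    (∀ x ∈ Set.Ioo x₁ x₂, f x ≠ 0) →
    ∃! x, x ∈ Set.Ioo x₁ x₂ ∧ g x = 0

/-- `f` and `g` have interlaced zeros on `I`. -/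
def InterlacedOn (f g : ℝ → ℝ) (I : Set ℝ) : Prop :=
  InterlaceHalf f g I ∧ InterlaceHalf g f I

/-! ### Abstract interlacing -/

/-- First zero to the right. -/
lemma exists_first_zero {f : ℝ → ℝ} {a b : ℝ} (hab : a ≤ b) (hc : ContinuousOn f (Icc a b))
    (ha : 0 < f a) (hb : f b ≤ 0) :
    ∃ c ∈ Ioc a b, f c = 0 ∧ ∀ x ∈ Ico a c, 0 < f x := by
  have hcl : IsClosed (Icc a b ∩ f ⁻¹' (Iic 0)) := hc.preimage_isClosed_of_isClosed isClosed_Icc isClosed_Iic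
  have hcomp : IsCompact (Icc a b ∩ f ⁻¹' (Iic 0)) :=
    isCompact_Icc.of_isClosed_subset hcl inter_subset_left
  obtain ⟨c, ⟨hcm, hcle⟩, hmin⟩ := hcomp.exists_isLeast ⟨b, ⟨⟨hab, le_rfl⟩, hb⟩⟩
  have hpos : ∀ x ∈ Ico a c, 0 < f x := by
    intro x hx
    by_contra h
    have : c ≤ x := hmin ⟨⟨hx.1, hx.2.le.trans hcm.2⟩, not_lt.mp h⟩
    exact absurd hx.2 (not_lt.mpr this)
  have hac : a < c := by
    rcases hcm.1.eq_or_lt with h | h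
    · exfalso; rw [← h] at hcle; exact absurd ha (not_lt.mpr hcle)
    · exact h
  refine ⟨c, ⟨hac, hcm.2⟩, ?_, hpos⟩
  obtain ⟨d, hd, hd0⟩ := intermediate_value_Icc' hac.le (hc.mono (Icc_subset_Icc_right hcm.2))
    ⟨hcle, ha.le⟩
  rcases hd.2.eq_or_lt with h | h
  · rw [← h]; exact hd0
  · exact absurd hd0 (hpos d ⟨hd.1, h⟩).ne'

lemma deriv_nonpos_of_pos_left {f : ℝ → ℝ} {f' a c : ℝ} (hac : a < c) (hf : HasDerivAt f f' c)
    (h0 : f c = 0) (hpos : ∀ x ∈ Ioo a c, 0 < f x) : f' ≤ 0 := by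
  have h1 := (hasDerivWithinAt_iff_tendsto_slope' (s := Iio c) (by simp)).1 hf.hasDerivWithinAt
  refine le_of_tendsto h1 ?_
  filter_upwards [Ioo_mem_nhdsLT hac] with x hx
  rw [slope_def_field, h0, sub_zero]
  exact div_nonpos_of_nonneg_of_nonpos (hpos x hx).le (by linarith [hx.2])

lemma deriv_nonneg_of_pos_right {f : ℝ → ℝ} {f' a c : ℝ} (hac : c < a) (hf : HasDerivAt f f' c)
    (h0 : f c = 0) (hpos : ∀ x ∈ Ioo c a, 0 < f x) : 0 ≤ f' := by
  have h1 := (hasDerivWithinAt_iff_tendsto_slope' (s := Ioi c) (by simp)).1 hf.hasDerivWithinAt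
  refine ge_of_tendsto h1 ?_
  filter_upwards [Ioo_mem_nhdsGT hac] with x hx
  rw [slope_def_field, h0, sub_zero]
  exact div_nonneg (hpos x hx).le (by linarith [hx.1])

/-- positive derivative at zero: positive just to the right -/
lemma exists_pos_right {f : ℝ → ℝ} {f' c b : ℝ} (hcb : c < b) (hf : HasDerivAt f f' c)
    (h0 : f c = 0) (hp : 0 < f') : ∃ a ∈ Ioo c b, 0 < f a := by
  have h1 := (hasDerivWithinAt_iff_tendsto_slope' (s := Ioi c) (by simp)).1 hf.hasDerivWithinAt
  have h2 := h1.eventually (lt_mem_nhds hp)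
  obtain ⟨x, hx, hx2⟩ := (h2.and (Ioo_mem_nhdsGT hcb)).exists
  refine ⟨x, hx2, ?_⟩
  rw [slope_def_field, h0, sub_zero] at hx
  have := mul_pos hx (sub_pos.2 hx2.1)
  rwa [div_mul_cancel₀ _ (sub_pos.2 hx2.1).ne'] at this

/-- at most one zero if the derivative is positive at each zero -/
lemma unique_zero_of_deriv_pos {g g' : ℝ → ℝ} {x₁ x₂ : ℝ} (hg : ∀ x ∈ Ioo x₁ x₂, HasDerivAt g (g' x) x)
    (hp : ∀ x ∈ Ioo x₁ x₂, g x = 0 → 0 < g' x) {a b : ℝ} (ha : a ∈ Ioo x₁ x₂)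
    (hb : b ∈ Ioo x₁ x₂) (hab : a < b) (ha0 : g a = 0) (hb0 : g b = 0) : False := by
  obtain ⟨d, hd, hd0⟩ := exists_pos_right hab (hg a ha) ha0 (hp a ha ha0)
  have hsub : Icc d b ⊆ Ioo x₁ x₂ := fun x hx =>
    ⟨ha.1.trans (hd.1.trans_le hx.1), hx.2.trans_lt hb.2⟩
  obtain ⟨c, hc, hc0, hcp⟩ := exists_first_zero hd.2.le
    (fun x hx => (hg x (hsub hx)).continuousAt.continuousWithinAt) hd0 hb0.le
  have hcm := hsub (Ioc_subset_Icc_self hc)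
  have := deriv_nonpos_of_pos_left hc.1 (hg c hcm) hc0 (fun x hx => hcp x ⟨hx.1.le, hx.2⟩)
  exact absurd (hp c hcm hc0) (not_lt.2 this)

lemma interlaceHalf_aux {f g f' g' : ℝ → ℝ}
    (hf : ∀ x, 0 < x → HasDerivAt f (f' x) x) (hg : ∀ x, 0 < x → HasDerivAt g (g' x) x)
    (h1 : ∀ x, 0 < x → f x = 0 → f' x * g x < 0) (h2 : ∀ x, 0 < x → g x = 0 → 0 < f x * g' x)
    (x₁ x₂ : ℝ) (hx₁ : 0 < x₁) (hlt : x₁ < x₂) (f1 : f x₁ = 0) (f2 : f x₂ = 0)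
    (hpos : ∀ x ∈ Ioo x₁ x₂, 0 < f x) : ∃! x, x ∈ Ioo x₁ x₂ ∧ g x = 0 := by
  have hx₂ := hx₁.trans hlt
  have d1 := deriv_nonneg_of_pos_right hlt (hf x₁ hx₁) f1 hpos
  have d2 := deriv_nonpos_of_pos_left hlt (hf x₂ hx₂) f2 hpos
  have g1 : g x₁ < 0 := by
    by_contra h; exact absurd (h1 x₁ hx₁ f1) (not_lt.2 (mul_nonneg d1 (not_lt.1 h)))
  have g2 : 0 < g x₂ := by
    by_contra h
    exact absurd (h1 x₂ hx₂ f2) (not_lt.2 (mul_nonneg_of_nonpos_of_nonpos d2 (not_lt.1 h)))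
  obtain ⟨c, hc, hc0⟩ := intermediate_value_Ioo hlt.le
    (fun x hx => (hg x (hx₁.trans_le hx.1)).continuousAt.continuousWithinAt) ⟨g1, g2⟩
  have key := @unique_zero_of_deriv_pos g g' x₁ x₂ (fun x hx => hg x (hx₁.trans hx.1))
    (fun x hx h0 => by
      have := h2 x (hx₁.trans hx.1) h0
      exact (pos_iff_pos_of_mul_pos this).1 (hpos x hx))
  refine ⟨c, ⟨hc, hc0⟩, ?_⟩
  rintro y ⟨hy, hy0⟩
  rcases lt_trichotomy y c with h | h | h
  · exact (key hy hc h hy0 hc0).elim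
  · exact h
  · exact (key hc hy h hc0 hy0).elim

lemma interlaceHalf_of {f g f' g' : ℝ → ℝ}
    (hf : ∀ x, 0 < x → HasDerivAt f (f' x) x) (hg : ∀ x, 0 < x → HasDerivAt g (g' x) x)
    (h1 : ∀ x, 0 < x → f x = 0 → f' x * g x < 0) (h2 : ∀ x, 0 < x → g x = 0 → 0 < f x * g' x) :
    InterlaceHalf f g (Ioi 0) := by
  intro x₁ hx₁ x₂ hx₂ hlt f1 f2 hne
  by_cases hp : ∀ x ∈ Ioo x₁ x₂, 0 < f x
  · exact interlaceHalf_aux hf hg h1 h2 x₁ x₂ hx₁ hlt f1 f2 hp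
  · have hn : ∀ x ∈ Ioo x₁ x₂, 0 < -f x := by
      by_contra hcon
      push Not at hp hcon
      obtain ⟨u, hu, hu0⟩ := hp
      obtain ⟨v, hv, hv0⟩ := hcon
      have hcont : ContinuousOn f (Ioo x₁ x₂) := fun x hx =>
        (hf x (lt_trans hx₁ hx.1)).continuousAt.continuousWithinAt
      obtain ⟨w, hw, hw0⟩ := isPreconnected_Ioo.intermediate_value hu hv hcont
        (show (0:ℝ) ∈ Icc (f u) (f v) from ⟨hu0, by linarith⟩)
      exact hne w hw hw0
    have := interlaceHalf_aux (f := fun x => -f x) (g := fun x => -g x) (fun x hx => (hf x hx).neg) (fun x hx => (hg x hx).neg)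
      (fun x hx h0 => by simpa using h1 x hx (by simpa using h0))
      (fun x hx h0 => by simpa using h2 x hx (by simpa using h0)) x₁ x₂ hx₁ hlt (by simpa using f1)
      (by simpa using f2) hn
    simpa using this

lemma interlacedOn_of {f g f' g' : ℝ → ℝ}
    (hf : ∀ x, 0 < x → HasDerivAt f (f' x) x) (hg : ∀ x, 0 < x → HasDerivAt g (g' x) x)
    (h1 : ∀ x, 0 < x → f x = 0 → f' x * g x < 0) (h2 : ∀ x, 0 < x → g x = 0 → 0 < f x * g' x) :
    InterlacedOn f g (Ioi 0) := by
  refine ⟨interlaceHalf_of hf hg h1 h2, ?_⟩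
  have := interlaceHalf_of (f := g) (g := fun x => - f x) hg (fun x hx => (hf x hx).neg)
    (fun x hx h0 => by have := h2 x hx h0; linarith)
    (fun x hx h0 => by have := h1 x hx (by simpa using h0); linarith)
  intro x₁ hx₁ x₂ hx₂ hlt g1 g2 hne
  simpa using this x₁ hx₁ x₂ hx₂ hlt g1 g2 hne

/-! ### Cylinder families -/

/-- Families satisfying the Bessel recurrences. -/
def IsCyl (C : ℝ → ℝ → ℝ) : Prop := ∀ ν x, 0 < x →
  HasDerivAt (C ν) ((C (ν - 1) x - C (ν + 1) x) / 2) x ∧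
    x * (C (ν - 1) x + C (ν + 1) x) = 2 * ν * C ν x

/-- the derivative -/
noncomputable def cylD (C : ℝ → ℝ → ℝ) (ν x : ℝ) : ℝ := (C (ν - 1) x - C (ν + 1) x) / 2

lemma IsCyl.hasDerivAt {C : ℝ → ℝ → ℝ} (h : IsCyl C) (ν : ℝ) {x : ℝ} (hx : 0 < x) :
    HasDerivAt (C ν) (cylD C ν x) x := (h ν x hx).1

lemma IsCyl.succ {C : ℝ → ℝ → ℝ} (h : IsCyl C) (ν : ℝ) {x : ℝ} (hx : 0 < x) :
    C (ν + 1) x = ν / x * C ν x - cylD C ν x := by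
  have := (h ν x hx).2
  unfold cylD; field_simp; linarith

lemma IsCyl.pred {C : ℝ → ℝ → ℝ} (h : IsCyl C) (ν : ℝ) {x : ℝ} (hx : 0 < x) :
    C (ν - 1) x = ν / x * C ν x + cylD C ν x := by
  have := (h ν x hx).2
  unfold cylD; field_simp; linarith

lemma IsCyl.succ_D {C : ℝ → ℝ → ℝ} (h : IsCyl C) (ν : ℝ) {x : ℝ} (hx : 0 < x) :
    cylD C (ν + 1) x = C ν x - (ν + 1) / x * C (ν + 1) x := by
  have := h.pred (ν + 1) hx
  rw [add_sub_cancel_right] at this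
  linarith

lemma IsCyl.hasDerivAt_D {C : ℝ → ℝ → ℝ} (h : IsCyl C) (ν : ℝ) {x : ℝ} (hx : 0 < x) :
    HasDerivAt (cylD C ν) (-(cylD C ν x) / x - (1 - ν ^ 2 / x ^ 2) * C ν x) x := by
  have e1 : HasDerivAt (fun y => ν / y * C ν y - C (ν + 1) y)
      ((-ν / x ^ 2) * C ν x + ν / x * cylD C ν x - cylD C (ν + 1) x) x := by
    have hd : HasDerivAt (fun y : ℝ => ν / y) (-ν / x ^ 2) x := by
      have := (hasDerivAt_inv hx.ne').const_mul ν
      simp only [div_eq_mul_inv]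
      exact this.congr_deriv (by ring)
    exact (hd.mul (h.hasDerivAt ν hx)).sub (h.hasDerivAt (ν + 1) hx)
  have e2 : HasDerivAt (cylD C ν)
      ((-ν / x ^ 2) * C ν x + ν / x * cylD C ν x - cylD C (ν + 1) x) x := by
    refine e1.congr_of_eventuallyEq ?_
    filter_upwards [lt_mem_nhds hx] with y hy
    rw [h.succ ν hy]; ring
  convert e2 using 1
  rw [h.succ_D ν hx, h.succ ν hx]
  field_simp
  ring

/-- The derivative of order two higher, expressed through the function and its derivative. -/
lemma IsCyl.E_eq {C : ℝ → ℝ → ℝ} (h : IsCyl C) (ν : ℝ) {x : ℝ} (hx : 0 < x) :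
    cylD C (ν + 2) x = 2 * (ν + 1) * (x ^ 2 - ν * (ν + 2)) / x ^ 3 * C ν x +
      (2 * (ν + 1) * (ν + 2) - x ^ 2) / x ^ 2 * cylD C ν x := by
  have e : ν + 2 = (ν + 1) + 1 := by ring
  have h1 := h.succ ν hx
  have h2 := h.succ (ν + 1) hx
  have h3 := h.succ_D (ν + 1) hx
  have h4 := h.succ_D ν hx
  rw [← e] at h2 h3
  rw [h3, h2, h4, h1]
  field_simp
  ring

lemma IsCyl.D_eq {C : ℝ → ℝ → ℝ} (h : IsCyl C) (ν : ℝ) {x : ℝ} (hx : 0 < x)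
    (h0 : cylD C (ν + 2) x = 0) :
    cylD C ν x = - (2 * (ν + 1) * (x ^ 2 - ν * (ν + 2)) / x ^ 3) * C (ν + 2) x := by
  have e : ν + 2 = (ν + 1) + 1 := by ring
  have h1 := h.pred (ν + 2) hx
  have h2 := h.pred (ν + 1) hx
  have h3 := h.succ ν hx
  have h4 := h.succ (ν + 1) hx
  have e1 : ν + 2 - 1 = ν + 1 := by ring
  rw [e1, h0] at h1
  rw [add_sub_cancel_right] at h2
  rw [← e] at h4
  have h5 : cylD C ν x = ν / x * C ν x - C (ν + 1) x := by linarith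
  have h6 : C ν x = 2 * ((ν + 1) / x) * C (ν + 1) x - C (ν + 2) x := by linarith
  rw [h5, h6, h1]
  field_simp
  ring

theorem IsCyl.interlaced {C : ℝ → ℝ → ℝ} (h : IsCyl C) {ν : ℝ} (hν : 0 < ν)
    (hD : ∀ x ∈ Ioc 0 ν, 0 < cylD C ν x) (hE : ∀ x ∈ Ioc 0 (ν + 2), 0 < cylD C (ν + 2) x)
    (hne : ∀ x, 0 < x → cylD C ν x = 0 → C ν x ≠ 0)
    (hne2 : ∀ x, 0 < x → cylD C (ν + 2) x = 0 → C (ν + 2) x ≠ 0) :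
    InterlacedOn (cylD C ν) (cylD C (ν + 2)) (Ioi 0) := by
  -- zeros of D are large
  have hbig : ∀ z, 0 < z → cylD C ν z = 0 → ν < z ∧ 0 < z ^ 2 - ν * (ν + 2) := by
    intro z hz hz0
    have hνz : ν < z := by
      by_contra hc
      exact absurd hz0 (hD z ⟨hz, not_lt.1 hc⟩).ne'
    refine ⟨hνz, ?_⟩
    by_contra hcon
    obtain ⟨c, hc, hc0, hcp⟩ := exists_first_zero hνz.le
      (fun x hx => (h.hasDerivAt_D ν (hν.trans_le hx.1)).continuousAt.continuousWithinAt)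
      (hD ν ⟨hν, le_rfl⟩) hz0.le
    have hcpos : 0 < c := hν.trans hc.1
    have hd := deriv_nonpos_of_pos_left hc.1 (h.hasDerivAt_D ν hcpos) hc0
      (fun x hx => hcp x ⟨hx.1.le, hx.2⟩)
    rw [hc0] at hd
    have hpos : 0 < 1 - ν ^ 2 / c ^ 2 := by
      rw [sub_pos, div_lt_one (by positivity)]
      have := hc.1
      gcongr
    have hC : 0 ≤ C ν c := by
      by_contra hneg
      have := mul_neg_of_pos_of_neg hpos (not_le.1 hneg)
      simp only [neg_zero, zero_div, zero_sub] at hd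
      linarith
    have hc2 : c ^ 2 - ν * (ν + 2) ≤ 0 := by
      have : c ^ 2 ≤ z ^ 2 := by have := hc.2; gcongr
      linarith
    have hEc := h.E_eq ν hcpos
    rw [hc0, mul_zero, add_zero] at hEc
    have hle : c ≤ ν + 2 := by nlinarith
    have := hE c ⟨hcpos, hle⟩
    have hA : 2 * (ν + 1) * (c ^ 2 - ν * (ν + 2)) / c ^ 3 ≤ 0 :=
      div_nonpos_of_nonpos_of_nonneg (mul_nonpos_of_nonneg_of_nonpos (by positivity) hc2) (by positivity)
    have := mul_nonpos_of_nonpos_of_nonneg hA hC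
    linarith
  refine interlacedOn_of (fun x hx => h.hasDerivAt_D ν hx) (fun x hx => h.hasDerivAt_D (ν + 2) hx) ?_ ?_
  · intro x hx h0
    obtain ⟨hb1, hb2⟩ := hbig x hx h0
    rw [h.E_eq ν hx, h0]
    have hC := hne x hx h0
    have hpos : 0 < 1 - ν ^ 2 / x ^ 2 := by
      rw [sub_pos, div_lt_one (by positivity)]
      gcongr
    have : 0 < (1 - ν ^ 2 / x ^ 2) * (2 * (ν + 1) * (x ^ 2 - ν * (ν + 2)) / x ^ 3) * (C ν x) ^ 2 := by
      positivity
    simp only [neg_zero, zero_div, zero_sub, mul_zero, add_zero]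
    linarith
  · intro x hx h0
    have hb : ν + 2 < x := by
      by_contra hc
      exact absurd h0 (hE x ⟨hx, not_lt.1 hc⟩).ne'
    have hC := hne2 x hx h0
    rw [h.D_eq ν hx h0, h0]
    have hpos : 0 < 1 - (ν + 2) ^ 2 / x ^ 2 := by
      rw [sub_pos, div_lt_one (by positivity)]
      gcongr
    have hb2 : 0 < x ^ 2 - ν * (ν + 2) := by nlinarith
    have : 0 < (1 - (ν + 2) ^ 2 / x ^ 2) * (2 * (ν + 1) * (x ^ 2 - ν * (ν + 2)) / x ^ 3) * (C (ν + 2) x) ^ 2 := by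
      positivity
    simp only [neg_zero, zero_div, zero_sub]
    linarith

/-! ### Integral representations -/

noncomputable def intA (ν x : ℝ) : ℝ := ∫ θ in (0:ℝ)..π, cos (ν * θ - x * sin θ)
noncomputable def intB (ν x : ℝ) : ℝ := ∫ θ in (0:ℝ)..π, sin (ν * θ - x * sin θ)
noncomputable def intK (ν x : ℝ) : ℝ := ∫ t in Ioi (0:ℝ), exp (ν * t - x * sinh t)

noncomputable def schJ (ν x : ℝ) : ℝ := (intA ν x - sin (ν * π) * intK (-ν) x) / π
noncomputable def schY (ν x : ℝ) : ℝ := (-intB ν x - intK ν x - cos (ν * π) * intK (-ν) x) / π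

lemma sinh_lower {t : ℝ} (ht : 0 ≤ t) : t ^ 2 / 4 ≤ sinh t := by
  have h1 : 1 + t + t ^ 2 / 2 ≤ exp t := quadratic_le_exp_of_nonneg ht
  have h2 : exp (-t) ≤ 1 := exp_le_one_iff.2 (by linarith)
  rw [sinh_eq]; nlinarith

lemma expK_bound (ν : ℝ) {x : ℝ} (hx : 0 < x) :
    ∀ᶠ t in atTop, exp (ν * t - x * sinh t) ≤ exp (-1 * t) := by
  filter_upwards [eventually_ge_atTop (max 0 (4 * (ν + 1) / x))] with t ht
  have h0 : 0 ≤ t := (le_max_left _ _).trans ht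
  have h1 : 4 * (ν + 1) / x ≤ t := (le_max_right _ _).trans ht
  rw [div_le_iff₀ hx] at h1
  have h2 := sinh_lower h0
  have h3 := mul_le_mul_of_nonneg_left h2 hx.le
  have h4 := mul_le_mul_of_nonneg_right h1 h0
  exact exp_le_exp.2 (by nlinarith)

lemma integrableOn_expK (ν : ℝ) {x : ℝ} (hx : 0 < x) :
    MeasureTheory.IntegrableOn (fun t => exp (ν * t - x * sinh t)) (Ioi 0) := by
  refine integrable_of_isBigO_exp_neg one_pos (by fun_prop) ?_
  refine Asymptotics.IsBigO.of_bound 1 ?_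
  filter_upwards [expK_bound ν hx] with t ht
  simpa [abs_of_pos (exp_pos _)] using ht

lemma hasDerivAt_intK (ν : ℝ) {x : ℝ} (hx : 0 < x) :
    HasDerivAt (intK ν) ((intK (ν - 1) x - intK (ν + 1) x) / 2) x := by
  have key := (hasDerivAt_integral_of_dominated_loc_of_deriv_le
    (μ := MeasureTheory.volume.restrict (Ioi (0:ℝ))) (s := Ioi (x / 2)) (x₀ := x)
    (F := fun y t => exp (ν * t - y * sinh t))
    (F' := fun y t => exp (ν * t - y * sinh t) * (- sinh t))
    (bound := fun t => exp ((ν + 1) * t - (x / 2) * sinh t))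
    (Ioi_mem_nhds (by linarith))
    (Eventually.of_forall fun y => by fun_prop)
    (integrableOn_expK ν hx) (by fun_prop) ?_ (integrableOn_expK (ν + 1) (by linarith)) ?_).2
  · have e : (∫ t in Ioi (0:ℝ), exp (ν * t - x * sinh t) * (- sinh t)) =
        (intK (ν - 1) x - intK (ν + 1) x) / 2 := by
      unfold intK
      rw [← MeasureTheory.integral_sub (integrableOn_expK _ hx) (integrableOn_expK _ hx),
        ← MeasureTheory.integral_div]
      congr 1; ext t
      rw [show (ν - 1) * t - x * sinh t = (ν * t - x * sinh t) + (-t) by ring,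
        show (ν + 1) * t - x * sinh t = (ν * t - x * sinh t) + t by ring, exp_add, exp_add]
      rw [sinh_eq t]; ring
    rw [← e]; exact key
  · refine (MeasureTheory.ae_restrict_iff' measurableSet_Ioi).2 (Eventually.of_forall ?_)
    intro t ht y hy
    have ht0 : (0:ℝ) < t := ht
    have hy0 : x / 2 < y := hy
    have hs : 0 ≤ sinh t := sinh_nonneg_iff.2 ht0.le
    have hs2 : sinh t ≤ exp t := by
      have := exp_pos (-t); have := exp_pos t
      rw [sinh_eq]; linarith
    rw [norm_mul, norm_neg, norm_of_nonneg (exp_pos _).le, norm_of_nonneg hs,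
      show (ν + 1) * t - x / 2 * sinh t = (ν * t - x / 2 * sinh t) + t by ring, exp_add]
    gcongr
  · refine Eventually.of_forall fun t y _ => ?_
    have h1 : HasDerivAt (fun y : ℝ => ν * t - y * sinh t) (- sinh t) y := by
      have := ((hasDerivAt_id y).mul_const (sinh t)).const_sub (ν * t)
      simpa using this
    exact h1.exp

lemma recK (ν : ℝ) {x : ℝ} (hx : 0 < x) :
    x * (intK (ν - 1) x + intK (ν + 1) x) = 2 + 2 * ν * intK ν x := by
  have hI : ∀ μ, MeasureTheory.Integrable (fun t => exp (μ * t - x * sinh t))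
    (MeasureTheory.volume.restrict (Ioi 0)) := fun μ => integrableOn_expK μ hx
  have hd : ∀ t ∈ Ici (0:ℝ), HasDerivAt (fun t => exp (ν * t - x * sinh t))
      (ν * exp (ν * t - x * sinh t) - (x / 2) * (exp ((ν - 1) * t - x * sinh t) +
        exp ((ν + 1) * t - x * sinh t))) t := by
    intro t _
    have h1 : HasDerivAt (fun t : ℝ => ν * t - x * sinh t) (ν - x * cosh t) t := by
      have := ((hasDerivAt_id t).const_mul ν).sub ((hasDerivAt_sinh t).const_mul x)
      exact this.congr_deriv (by simp)
    refine h1.exp.congr_deriv ?_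
    rw [show (ν - 1) * t - x * sinh t = (ν * t - x * sinh t) + (-t) by ring,
        show (ν + 1) * t - x * sinh t = (ν * t - x * sinh t) + t by ring, exp_add, exp_add,
        cosh_eq t]
    ring
  have hsum : MeasureTheory.Integrable (fun t => exp ((ν - 1) * t - x * sinh t) +
      exp ((ν + 1) * t - x * sinh t)) (MeasureTheory.volume.restrict (Ioi 0)) :=
    (hI (ν - 1)).add (hI (ν + 1))
  have hlim : Tendsto (fun t => exp (ν * t - x * sinh t)) atTop (𝓝 0) := by
    refine squeeze_zero' (Eventually.of_forall fun t => (exp_pos _).le) (expK_bound ν hx) ?_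
    simpa using tendsto_exp_neg_atTop_nhds_zero
  have h := MeasureTheory.integral_Ioi_of_hasDerivAt_of_tendsto' hd
    (((hI ν).const_mul ν).sub (hsum.const_mul (x / 2))) hlim
  rw [MeasureTheory.integral_sub ((hI ν).const_mul ν)
    (hsum.const_mul (x / 2)), MeasureTheory.integral_const_mul,
    MeasureTheory.integral_const_mul, MeasureTheory.integral_add (hI (ν - 1)) (hI (ν + 1))] at h
  change ν * intK ν x - x / 2 * (intK (ν - 1) x + intK (ν + 1) x) = _ at h
  simp at h
  linarith

lemma continuousAt_intK (ν : ℝ) {x : ℝ} (hx : 0 < x) : ContinuousAt (fun μ => intK μ x) ν := by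
  refine MeasureTheory.continuousAt_of_dominated (bound := fun t => exp ((ν + 1) * t - x * sinh t))
    (Eventually.of_forall fun y => by fun_prop) ?_ (integrableOn_expK (ν + 1) hx)
    (Eventually.of_forall fun t => by fun_prop)
  filter_upwards [gt_mem_nhds (show ν < ν + 1 by linarith)] with μ hμ
  refine (MeasureTheory.ae_restrict_iff' measurableSet_Ioi).2 (Eventually.of_forall ?_)
  intro t ht
  have ht0 : (0:ℝ) < t := ht
  rw [norm_of_nonneg (exp_pos _).le]
  gcongr

lemma continuous_intA_order (x : ℝ) : Continuous (fun μ => intA μ x) :=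
  intervalIntegral.continuous_parametric_intervalIntegral_of_continuous' (by fun_prop) _ _
lemma continuous_intA (ν : ℝ) : Continuous (fun x => intA ν x) :=
  intervalIntegral.continuous_parametric_intervalIntegral_of_continuous' (by fun_prop) _ _
lemma continuous_intB_order (x : ℝ) : Continuous (fun μ => intB μ x) :=
  intervalIntegral.continuous_parametric_intervalIntegral_of_continuous' (by fun_prop) _ _

lemma hasDerivAt_intA (ν x : ℝ) :
    HasDerivAt (intA ν) ((intA (ν - 1) x - intA (ν + 1) x) / 2) x := by
  have key := (intervalIntegral.hasDerivAt_integral_of_dominated_loc_of_deriv_le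
    (μ := MeasureTheory.volume) (a := 0) (b := π) (s := univ) (x₀ := x)
    (F := fun y θ => cos (ν * θ - y * sin θ))
    (F' := fun y θ => sin (ν * θ - y * sin θ) * sin θ)
    (bound := fun _ => 1) univ_mem
    (Eventually.of_forall fun y => by fun_prop)
    (Continuous.intervalIntegrable (by fun_prop) _ _) (by fun_prop)
    (Eventually.of_forall fun θ _ y _ => ?_) (by simp) (Eventually.of_forall fun θ _ y _ => ?_)).2
  · refine key.congr_deriv ?_
    unfold intA
    rw [← intervalIntegral.integral_sub (Continuous.intervalIntegrable (by fun_prop) _ _)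
      (Continuous.intervalIntegrable (by fun_prop) _ _), ← intervalIntegral.integral_div]
    congr 1; ext θ
    rw [show (ν - 1) * θ - x * sin θ = (ν * θ - x * sin θ) - θ by ring,
        show (ν + 1) * θ - x * sin θ = (ν * θ - x * sin θ) + θ by ring, cos_sub, cos_add]
    ring
  · rw [norm_mul]
    exact mul_le_one₀ (abs_sin_le_one _) (norm_nonneg _) (abs_sin_le_one _)
  · have h1 : HasDerivAt (fun y : ℝ => ν * θ - y * sin θ) (- sin θ) y := by
      have := ((hasDerivAt_id y).mul_const (sin θ)).const_sub (ν * θ)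
      simpa using this
    exact h1.cos.congr_deriv (by ring)

lemma hasDerivAt_intB (ν x : ℝ) :
    HasDerivAt (intB ν) (-∫ θ in (0:ℝ)..π, cos (ν * θ - x * sin θ) * sin θ) x := by
  have key := (intervalIntegral.hasDerivAt_integral_of_dominated_loc_of_deriv_le
    (μ := MeasureTheory.volume) (a := 0) (b := π) (s := univ) (x₀ := x)
    (F := fun y θ => sin (ν * θ - y * sin θ))
    (F' := fun y θ => -(cos (ν * θ - y * sin θ) * sin θ))
    (bound := fun _ => 1) univ_mem
    (Eventually.of_forall fun y => by fun_prop)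
    (Continuous.intervalIntegrable (by fun_prop) _ _) (by fun_prop)
    (Eventually.of_forall fun θ _ y _ => ?_) (by simp) (Eventually.of_forall fun θ _ y _ => ?_)).2
  · refine key.congr_deriv ?_
    rw [intervalIntegral.integral_neg]
  · rw [norm_neg, norm_mul]
    exact mul_le_one₀ (abs_cos_le_one _) (norm_nonneg _) (abs_sin_le_one _)
  · have h1 : HasDerivAt (fun y : ℝ => ν * θ - y * sin θ) (- sin θ) y := by
      have := ((hasDerivAt_id y).mul_const (sin θ)).const_sub (ν * θ)
      simpa using this
    exact h1.sin.congr_deriv (by ring)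

lemma derivB_eq (ν x : ℝ) : (-∫ θ in (0:ℝ)..π, cos (ν * θ - x * sin θ) * sin θ) =
    (intB (ν - 1) x - intB (ν + 1) x) / 2 := by
  unfold intB
  rw [← intervalIntegral.integral_sub (Continuous.intervalIntegrable (by fun_prop) _ _)
    (Continuous.intervalIntegrable (by fun_prop) _ _), ← intervalIntegral.integral_div,
    ← intervalIntegral.integral_neg]
  congr 1; ext θ
  rw [show (ν - 1) * θ - x * sin θ = (ν * θ - x * sin θ) - θ by ring,
      show (ν + 1) * θ - x * sin θ = (ν * θ - x * sin θ) + θ by ring, sin_sub, sin_add]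
  ring

lemma hasDerivAt_phase (ν x θ : ℝ) :
    HasDerivAt (fun θ : ℝ => ν * θ - x * sin θ) (ν - x * cos θ) θ := by
  have := ((hasDerivAt_id θ).const_mul ν).sub ((hasDerivAt_sin θ).const_mul x)
  exact this.congr_deriv (by simp)

lemma recA (ν x : ℝ) :
    x * (intA (ν - 1) x + intA (ν + 1) x) = 2 * ν * intA ν x - 2 * sin (ν * π) := by
  have h := intervalIntegral.integral_eq_sub_of_hasDerivAt (a := 0) (b := π)
    (fun θ _ => (hasDerivAt_phase ν x θ).sin) (Continuous.intervalIntegrable (by fun_prop) _ _)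
  simp only [sin_pi, mul_zero, sub_zero, sin_zero] at h
  rw [← h]
  unfold intA
  rw [← intervalIntegral.integral_add (Continuous.intervalIntegrable (by fun_prop) _ _)
    (Continuous.intervalIntegrable (by fun_prop) _ _), ← intervalIntegral.integral_const_mul,
    ← intervalIntegral.integral_const_mul, ← intervalIntegral.integral_const_mul,
    ← intervalIntegral.integral_sub (Continuous.intervalIntegrable (by fun_prop) _ _)
    (Continuous.intervalIntegrable (by fun_prop) _ _)]
  congr 1; ext θ
  rw [show (ν - 1) * θ - x * sin θ = (ν * θ - x * sin θ) - θ by ring,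
      show (ν + 1) * θ - x * sin θ = (ν * θ - x * sin θ) + θ by ring, cos_sub, cos_add]
  ring

lemma recB (ν x : ℝ) :
    x * (intB (ν - 1) x + intB (ν + 1) x) = 2 * ν * intB ν x - 2 * (1 - cos (ν * π)) := by
  have h := intervalIntegral.integral_eq_sub_of_hasDerivAt (a := 0) (b := π)
    (fun θ _ => (hasDerivAt_phase ν x θ).cos) (Continuous.intervalIntegrable (by fun_prop) _ _)
  simp only [sin_pi, mul_zero, sub_zero, sin_zero, cos_zero] at h
  rw [show 1 - cos (ν * π) = -(cos (ν * π) - 1) by ring, ← h]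
  unfold intB
  rw [← intervalIntegral.integral_add (Continuous.intervalIntegrable (by fun_prop) _ _)
    (Continuous.intervalIntegrable (by fun_prop) _ _), ← intervalIntegral.integral_neg,
    ← intervalIntegral.integral_const_mul,
    ← intervalIntegral.integral_const_mul, ← intervalIntegral.integral_const_mul,
    ← intervalIntegral.integral_sub (Continuous.intervalIntegrable (by fun_prop) _ _)
    (Continuous.intervalIntegrable (by fun_prop) _ _)]
  congr 1; ext θ
  rw [show (ν - 1) * θ - x * sin θ = (ν * θ - x * sin θ) - θ by ring,
      show (ν + 1) * θ - x * sin θ = (ν * θ - x * sin θ) + θ by ring, sin_sub, sin_add]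
  ring

lemma isCyl_schJ : IsCyl schJ := by
  intro ν x hx
  have s1 : sin ((ν - 1) * π) = - sin (ν * π) := by
    rw [sub_mul, one_mul, sin_sub_pi]
  have s2 : sin ((ν + 1) * π) = - sin (ν * π) := by
    rw [add_mul, one_mul, sin_add_pi]
  have e1 : -(ν - 1) = -ν + 1 := by ring
  have e2 : -(ν + 1) = -ν - 1 := by ring
  constructor
  · have := ((hasDerivAt_intA ν x).sub ((hasDerivAt_intK (-ν) hx).const_mul (sin (ν * π)))).div_const π
    refine this.congr_deriv ?_
    unfold schJ
    rw [s1, s2, e1, e2]; ring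
  · have h1 := recA ν x
    have h2 := recK (-ν) hx
    unfold schJ
    rw [s1, s2, e1, e2]
    field_simp
    linear_combination h1 + sin (ν * π) * h2

lemma isCyl_schY : IsCyl schY := by
  intro ν x hx
  have s1 : cos ((ν - 1) * π) = - cos (ν * π) := by
    rw [sub_mul, one_mul, cos_sub_pi]
  have s2 : cos ((ν + 1) * π) = - cos (ν * π) := by
    rw [add_mul, one_mul, cos_add_pi]
  have e1 : -(ν - 1) = -ν + 1 := by ring
  have e2 : -(ν + 1) = -ν - 1 := by ring
  constructor
  · have hB := hasDerivAt_intB ν x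
    rw [derivB_eq] at hB
    have := ((hB.neg.sub (hasDerivAt_intK ν hx)).sub
      ((hasDerivAt_intK (-ν) hx).const_mul (cos (ν * π)))).div_const π
    refine this.congr_deriv ?_
    unfold schY
    rw [s1, s2, e1, e2]; ring
  · have h1 := recB ν x
    have h2 := recK (-ν) hx
    have h3 := recK ν hx
    unfold schY
    rw [s1, s2, e1, e2]
    field_simp
    linear_combination -h1 - h3 + cos (ν * π) * h2

lemma intA_neg (ν x : ℝ) : intA (-ν) x = cos (ν * π) * intA ν x + sin (ν * π) * intB ν x := by
  have h := intervalIntegral.integral_comp_sub_left (a := 0) (b := π)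
    (fun θ => cos (-ν * θ - x * sin θ)) π
  simp only [sub_self, sub_zero] at h
  unfold intA intB
  rw [← h, ← intervalIntegral.integral_const_mul, ← intervalIntegral.integral_const_mul,
    ← intervalIntegral.integral_add (Continuous.intervalIntegrable (by fun_prop) _ _)
    (Continuous.intervalIntegrable (by fun_prop) _ _)]
  congr 1; ext θ
  rw [sin_pi_sub, ← cos_sub, ← cos_neg]
  congr 1; ring

lemma schY_rel (ν x : ℝ) :
    schJ ν x * cos (ν * π) - schJ (-ν) x = sin (ν * π) * schY ν x := by
  unfold schJ schY
  rw [intA_neg, neg_neg, neg_mul, sin_neg]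
  ring

lemma continuousAt_schY (ν : ℝ) {x : ℝ} (hx : 0 < x) : ContinuousAt (fun μ => schY μ x) ν := by
  have h1 := (continuous_intB_order x).continuousAt (x := ν)
  have h2 := continuousAt_intK ν hx
  have h3 : ContinuousAt (fun μ => intK (-μ) x) ν :=
    ContinuousAt.comp (f := fun μ : ℝ => -μ) (g := fun μ => intK μ x) (continuousAt_intK (-ν) hx)
      (by fun_prop)
  have h4 : ContinuousAt (fun μ : ℝ => cos (μ * π)) ν := by fun_prop
  exact ((h1.neg.sub h2).sub (h4.mul h3)).div_const π

/-- If the series equals the Schläfli integral then so does `Y`. -/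
lemma besselY_eq_schY (hJ : ∀ ν x, 0 < x → besselJ ν x = schJ ν x) (ν : ℝ) {x : ℝ} (hx : 0 < x) :
    besselY ν x = schY ν x := by
  unfold besselY
  have hne : (𝓝[{μ : ℝ | ∀ n : ℤ, μ ≠ (n : ℝ)}] ν).NeBot := by
    rw [← mem_closure_iff_nhdsWithin_neBot]
    have hd : Dense {μ : ℝ | ∀ n : ℤ, μ ≠ (n : ℝ)} := by
      have : {μ : ℝ | ∀ n : ℤ, μ ≠ (n : ℝ)} = (range ((↑) : ℤ → ℝ))ᶜ := by
        ext μ; simp [eq_comm]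
      rw [this]
      exact (countable_range _).dense_compl ℝ
    exact hd ν
  apply Tendsto.limUnder_eq
  have h1 : Tendsto (fun μ => schY μ x) (𝓝[{μ : ℝ | ∀ n : ℤ, μ ≠ (n : ℝ)}] ν) (𝓝 (schY ν x)) :=
    (continuousAt_schY ν hx).tendsto.mono_left nhdsWithin_le_nhds
  refine h1.congr' ?_
  filter_upwards [self_mem_nhdsWithin] with μ hμ
  have hs : sin (μ * π) ≠ 0 := by
    intro h0
    obtain ⟨n, hn⟩ := sin_eq_zero_iff.1 h0
    exact hμ n (mul_right_cancel₀ pi_ne_zero hn).symm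
  rw [hJ μ x hx, hJ (-μ) x hx, schY_rel, mul_div_cancel_left₀ _ hs]

/-! ### The power series -/

noncomputable def bc (ν : ℝ) (m : ℕ) : ℝ :=
  (-1 : ℝ) ^ m / (m.factorial * Real.Gamma ((m : ℝ) + ν + 1))

noncomputable def phi (ν y : ℝ) : ℝ := ∑' m : ℕ, bc ν m * y ^ m

lemma bc_succ (ν : ℝ) (m : ℕ) : ((m : ℝ) + 1) * bc ν (m + 1) = - bc (ν + 1) m := by
  unfold bc
  have e : ((m + 1 : ℕ) : ℝ) + ν + 1 = (m : ℝ) + (ν + 1) + 1 := by push_cast; ring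
  have h : ((m : ℝ) + 1) ≠ 0 := by positivity
  rw [e, Nat.factorial_succ, pow_succ]
  push_cast
  rw [mul_assoc ((m:ℝ) + 1), ← mul_div_assoc, mul_div_mul_left _ _ h]
  ring

lemma bc_pred (ν : ℝ) (m : ℕ) : ((m : ℝ) + ν) * bc ν m = bc (ν - 1) m := by
  unfold bc
  have e : (m : ℝ) + (ν - 1) + 1 = m + ν := by ring
  rw [e]
  by_cases h : (m : ℝ) + ν = 0
  · rw [h, Real.Gamma_zero]; simp
  · rw [Real.Gamma_add_one h, mul_left_comm, ← mul_div_assoc, mul_div_mul_left _ _ h]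

lemma bc_bound (ν : ℝ) : ∃ M : ℝ, 0 ≤ M ∧ ∀ m : ℕ, |bc ν m| ≤ M / m.factorial := by
  obtain ⟨N, hN⟩ := exists_nat_ge (1 - ν)
  have h1 : ∀ m : ℕ, N ≤ m → |(Real.Gamma ((m : ℝ) + ν + 1))⁻¹| ≤ 1 := by
    intro m hm
    have hm' : (N : ℝ) ≤ m := by exact_mod_cast hm
    have h2 : (2 : ℝ) ≤ (m : ℝ) + ν + 1 := by linarith
    have h3 : 1 ≤ Real.Gamma ((m : ℝ) + ν + 1) := by
      have := Real.Gamma_strictMonoOn_Ici.monotoneOn (mem_Ici.2 le_rfl) h2 h2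
      rwa [Real.Gamma_two] at this
    rw [abs_inv, abs_of_pos (by linarith)]
    exact inv_le_one_of_one_le₀ h3
  refine ⟨1 + ∑ m ∈ Finset.range N, |(Real.Gamma ((m : ℝ) + ν + 1))⁻¹|, by positivity, ?_⟩
  intro m
  have h2 : |(Real.Gamma ((m : ℝ) + ν + 1))⁻¹| ≤
      1 + ∑ m ∈ Finset.range N, |(Real.Gamma ((m : ℝ) + ν + 1))⁻¹| := by
    by_cases hm : N ≤ m
    · have : 0 ≤ ∑ m ∈ Finset.range N, |(Real.Gamma ((m : ℝ) + ν + 1))⁻¹| := by positivity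
      linarith [h1 m hm]
    · have := Finset.single_le_sum (f := fun m : ℕ => |(Real.Gamma ((m : ℝ) + ν + 1))⁻¹|)
        (fun i _ => abs_nonneg _) (Finset.mem_range.2 (not_le.1 hm))
      linarith
  have e : |bc ν m| = |(Real.Gamma ((m : ℝ) + ν + 1))⁻¹| / m.factorial := by
    unfold bc
    rw [abs_div, abs_pow, abs_neg, abs_one, one_pow, abs_mul, abs_inv, Nat.abs_cast]
    rw [one_div, mul_inv]; ring
  rw [e]
  gcongr

lemma bc_summable (ν y : ℝ) : Summable (fun m => bc ν m * y ^ m) := by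
  obtain ⟨M, hM, h⟩ := bc_bound ν
  refine Summable.of_norm_bounded ((Real.summable_pow_div_factorial |y|).mul_left M) ?_
  intro m
  rw [norm_mul, norm_pow, norm_eq_abs, norm_eq_abs]
  calc _ ≤ M / m.factorial * |y| ^ m := by gcongr; exact h m
    _ = _ := by ring

lemma bc_deriv_sum (ν y : ℝ) : (fun m : ℕ => bc ν (m + 1) * (((m + 1 : ℕ) : ℝ) * y ^ m)) =
    fun m => -(bc (ν + 1) m * y ^ m) := by
  ext m
  have := bc_succ ν m
  push_cast
  linear_combination y ^ m * this

lemma bc_deriv_summable (ν y : ℝ) :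
    Summable (fun m : ℕ => bc ν m * ((m : ℝ) * y ^ (m - 1))) := by
  rw [← summable_nat_add_iff 1]
  simp only [Nat.add_sub_cancel]
  rw [bc_deriv_sum]
  exact (bc_summable _ _).neg

lemma bc_deriv_tsum (ν y : ℝ) :
    ∑' m : ℕ, bc ν m * ((m : ℝ) * y ^ (m - 1)) = - phi (ν + 1) y := by
  rw [(bc_deriv_summable ν y).tsum_eq_zero_add]
  simp only [Nat.add_sub_cancel]
  rw [bc_deriv_sum, tsum_neg]
  simp [phi]

lemma hasDerivAt_phi (ν y : ℝ) : HasDerivAt (phi ν) (- phi (ν + 1) y) y := by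
  rw [← bc_deriv_tsum]
  obtain ⟨M, hM, h⟩ := bc_bound ν
  set R := |y| + 1 with hR
  have hR0 : 0 ≤ R := by positivity
  have hu : Summable (fun m : ℕ => M / m.factorial * ((m : ℝ) * R ^ (m - 1))) := by
    rw [← summable_nat_add_iff 1]
    refine ((Real.summable_pow_div_factorial R).mul_left M).congr ?_
    intro m
    rw [Nat.factorial_succ, Nat.add_sub_cancel]
    have h1 : ((m : ℝ) + 1) ≠ 0 := by positivity
    have h2 : (m.factorial : ℝ) ≠ 0 := by positivity
    push_cast
    field_simp
  refine hasDerivAt_tsum_of_isPreconnected (t := Metric.ball 0 R) (y₀ := 0) hu Metric.isOpen_ball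
    (convex_ball _ _).isPreconnected
    (g := fun m z => bc ν m * z ^ m) (g' := fun m z => bc ν m * ((m : ℝ) * z ^ (m - 1)))
    (fun m z _ => ?_) (fun m z hz => ?_) (by simp [hR]; positivity) (bc_summable ν 0) (by simp [hR])
  · exact (hasDerivAt_pow m z).const_mul _
  · have hz' : |z| ≤ R := by simpa using (mem_ball_zero_iff.1 hz).le
    rw [norm_mul, norm_mul, norm_pow, norm_eq_abs, norm_eq_abs, norm_eq_abs, Nat.abs_cast]
    gcongr
    exact h m

lemma phi_pred (ν y : ℝ) : phi (ν - 1) y = ν * phi ν y - y * phi (ν + 1) y := by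
  have h := bc_deriv_tsum ν y
  have e : y * phi (ν + 1) y = - ∑' m : ℕ, y * (bc ν m * ((m : ℝ) * y ^ (m - 1))) := by
    rw [tsum_mul_left, h]; ring
  rw [e, sub_neg_eq_add]
  unfold phi
  rw [← tsum_mul_left, ← ((bc_summable ν y).mul_left ν).tsum_add ((bc_deriv_summable ν y).mul_left y)]
  congr 1; ext m
  rw [← bc_pred]
  rcases m with _ | m
  · simp
  · simp only [Nat.add_sub_cancel]; push_cast; ring

lemma besselJ_eq (ν : ℝ) {x : ℝ} (hx : 0 < x) :
    besselJ ν x = (x / 2) ^ ν * phi ν ((x / 2) ^ 2) := by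
  unfold besselJ phi
  rw [← tsum_mul_left]
  congr 1; ext m
  have h : (0:ℝ) < x / 2 := by positivity
  rw [rpow_add h, rpow_mul h.le, ← bc]
  norm_num
  ring

lemma isCyl_besselJ : IsCyl besselJ := by
  intro ν x hx
  have h : (0:ℝ) < x / 2 := by positivity
  have e0 : (x / 2) ^ ν = (x / 2) ^ (ν - 1) * (x / 2) := by
    rw [← rpow_add_one h.ne']; congr 1; ring
  have e1 : (x / 2) ^ (ν + 1) = (x / 2) ^ (ν - 1) * (x / 2) ^ 2 := by
    rw [rpow_add_one h.ne', e0]; ring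
  have hp := phi_pred ν ((x / 2) ^ 2)
  rw [besselJ_eq _ hx, besselJ_eq _ hx, besselJ_eq _ hx, e1, hp]
  constructor
  · have hh : HasDerivAt (fun y : ℝ => y / 2) (1 / 2) x := (hasDerivAt_id x).div_const 2
    have h1 := hh.rpow_const (p := ν) (Or.inl h.ne')
    have h2 := (hasDerivAt_phi ν ((x / 2) ^ 2)).comp x (hh.pow 2)
    have h3 := h1.mul h2
    have h4 : HasDerivAt (besselJ ν) _ x := h3.congr_of_eventuallyEq (by
      filter_upwards [lt_mem_nhds hx] with y hy
      rw [besselJ_eq ν hy]; rfl)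
    refine h4.congr_deriv ?_
    simp only [Function.comp, e0, Pi.pow_apply]
    push_cast
    ring
  · rw [e0]; ring

lemma tendsto_phi (ν : ℝ) : Tendsto (fun x : ℝ => phi ν ((x / 2) ^ 2)) (𝓝[>] 0)
    (𝓝 (1 / Real.Gamma (ν + 1))) := by
  have h0 : phi ν 0 = 1 / Real.Gamma (ν + 1) := by
    unfold phi
    rw [tsum_eq_single 0]
    · simp [bc]
    · intro m hm; simp [hm]
  have hc : ContinuousAt (fun x : ℝ => phi ν ((x / 2) ^ 2)) 0 :=
    ContinuousAt.comp (f := fun x : ℝ => (x / 2) ^ 2) (hasDerivAt_phi ν _).continuousAt (by fun_prop)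
  have := hc.tendsto
  simp only [zero_div, ne_eq, OfNat.ofNat_ne_zero, not_false_eq_true, zero_pow, h0] at this
  exact this.mono_left nhdsWithin_le_nhds

/-! ### Identification of the series with the integral -/

lemma nonneg_of_deriv_nonneg {h h' : ℝ → ℝ} {X : ℝ}
    (hd : ∀ x ∈ Ioo 0 X, HasDerivAt h (h' x) x) (hp : ∀ x ∈ Ioo 0 X, 0 ≤ h' x)
    (hl : Tendsto h (𝓝[>] 0) (𝓝 0)) : ∀ x ∈ Ioo 0 X, 0 ≤ h x := by
  have hm : MonotoneOn h (Ioo 0 X) := by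
    refine monotoneOn_of_deriv_nonneg (convex_Ioo 0 X)
      (fun x hx => (hd x hx).continuousAt.continuousWithinAt) ?_ ?_
    · rw [interior_Ioo]; exact fun x hx => (hd x hx).differentiableAt.differentiableWithinAt
    · rw [interior_Ioo]; intro x hx; rw [(hd x hx).deriv]; exact hp x hx
  intro x hx
  refine le_of_tendsto hl ?_
  filter_upwards [Ioo_mem_nhdsGT hx.1] with y hy
  exact hm ⟨hy.1, hy.2.trans hx.2⟩ hx hy.2.le

lemma abs_le_of_deriv_le {f f' g g' : ℝ → ℝ} {X : ℝ}
    (hf : ∀ x ∈ Ioo 0 X, HasDerivAt f (f' x) x) (hg : ∀ x ∈ Ioo 0 X, HasDerivAt g (g' x) x)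
    (hp : ∀ x ∈ Ioo 0 X, |f' x| ≤ g' x)
    (hfl : Tendsto f (𝓝[>] 0) (𝓝 0)) (hgl : Tendsto g (𝓝[>] 0) (𝓝 0)) :
    ∀ x ∈ Ioo 0 X, |f x| ≤ g x := by
  intro x hx
  have h1 := nonneg_of_deriv_nonneg (h := fun x => g x - f x) (h' := fun x => g' x - f' x)
    (fun x hx => (hg x hx).sub (hf x hx))
    (fun x hx => by have := le_abs_self (f' x); linarith [hp x hx])
    (by simpa using hgl.sub hfl) x hx
  have h2 := nonneg_of_deriv_nonneg (h := fun x => g x + f x) (h' := fun x => g' x + f' x)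
    (fun x hx => (hg x hx).add (hf x hx))
    (fun x hx => by have := neg_abs_le (f' x); linarith [hp x hx])
    (by simpa using hgl.add hfl) x hx
  exact abs_le.2 ⟨by linarith, by linarith⟩

lemma tendsto_const_rpow {p : ℝ} (hp : 0 < p) (c : ℝ) :
    Tendsto (fun x : ℝ => c * x ^ p) (𝓝[>] 0) (𝓝 0) := by
  have h : ContinuousAt (fun x : ℝ => c * x ^ p) 0 :=
    (continuousAt_rpow_const 0 p (Or.inr hp.le)).const_mul c
  have := h.tendsto
  simp only [zero_rpow hp.ne', mul_zero] at this
  exact this.mono_left nhdsWithin_le_nhds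

lemma system_zero {U V : ℝ → ℝ} {α : ℝ} (hα : 0 < α)
    (hU : ∀ x, 0 < x → HasDerivAt U (-(x ^ (1 - 2 * α) * V x)) x)
    (hV : ∀ x, 0 < x → HasDerivAt V (x ^ (2 * α - 1) * U x) x)
    (hUl : Tendsto U (𝓝[>] 0) (𝓝 0)) (hVl : Tendsto V (𝓝[>] 0) (𝓝 0)) :
    ∀ x, 0 < x → U x = 0 := by
  intro x₀ hx₀
  set X := x₀ + 1 with hX
  -- boundedness
  obtain ⟨K, hK0, hK⟩ : ∃ K : ℝ, 0 ≤ K ∧ ∀ x ∈ Ioo 0 X, |U x| ≤ K := by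
    have h1 : ∀ᶠ x in 𝓝[>] (0:ℝ), |U x| < 1 := by
      have := hUl.abs
      rw [abs_zero] at this
      exact this.eventually (gt_mem_nhds one_pos)
    obtain ⟨δ, hδ, hδ1⟩ := (mem_nhdsGT_iff_exists_Ioo_subset).1 h1
    have hδ0 : (0:ℝ) < δ := hδ
    obtain ⟨M, hM⟩ := (isCompact_Icc (a := δ) (b := X)).exists_bound_of_continuousOn
      (f := U) (fun x hx => (hU x (hδ0.trans_le hx.1)).continuousAt.continuousWithinAt)
    refine ⟨max 1 M, le_max_of_le_left zero_le_one, fun x hx => ?_⟩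
    rcases lt_or_ge x δ with h | h
    · exact (hδ1 ⟨hx.1, h⟩ : |U x| < 1).le.trans (le_max_left _ _)
    · exact (hM x ⟨h, hx.2.le⟩).trans (le_max_right _ _)
  have key : ∀ n : ℕ, ∀ x ∈ Ioo 0 X, |U x| ≤ K / ((4 * α) ^ n * n.factorial) * x ^ (2 * n) := by
    intro n
    induction n with
    | zero => simpa using hK
    | succ n ih =>
      set B := K / ((4 * α) ^ n * n.factorial) with hB
      have hB0 : 0 ≤ B := by positivity
      have hp : (0:ℝ) < 2 * n + 2 * α := by positivity
      have hVb : ∀ x ∈ Ioo 0 X, |V x| ≤ B / (2 * n + 2 * α) * x ^ (2 * (n:ℝ) + 2 * α) := by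
        refine abs_le_of_deriv_le (fun x hx => hV x hx.1)
          (fun x hx => (hasDerivAt_rpow_const (p := 2 * (n:ℝ) + 2 * α) (Or.inl hx.1.ne')).const_mul _)
          ?_ hVl (tendsto_const_rpow hp _)
        intro x hx
        have hx0 : 0 < x := hx.1
        rw [abs_mul, abs_of_pos (rpow_pos_of_pos hx0 _)]
        have e : x ^ (2 * (n:ℝ) + 2 * α - 1) = x ^ (2 * α - 1) * x ^ (2 * n) := by
          rw [← rpow_natCast, ← rpow_add hx0]; congr 1; push_cast; ring
        rw [e]
        calc _ ≤ x ^ (2 * α - 1) * (B * x ^ (2 * n)) := by gcongr; exact ih x hx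
          _ = _ := by field_simp
      have hg : ∀ x ∈ Ioo 0 X, HasDerivAt (fun x : ℝ => B / ((4 * α) * (n + 1)) * x ^ (2 * (n + 1)))
          (B / (2 * α) * x ^ (2 * n + 1)) x := by
        intro x hx
        refine ((hasDerivAt_pow (2 * (n + 1)) x).const_mul _).congr_deriv ?_
        rw [show 2 * (n + 1) - 1 = 2 * n + 1 by omega]
        push_cast
        field_simp
        ring
      have hUb := abs_le_of_deriv_le (fun x hx => hU x hx.1) hg ?_ hUl ?_
      · intro x hx
        refine (hUb x hx).trans (le_of_eq ?_)
        rw [hB, Nat.factorial_succ, pow_succ]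
        push_cast
        field_simp
      · intro x hx
        have hx0 : 0 < x := hx.1
        rw [abs_neg, abs_mul, abs_of_pos (rpow_pos_of_pos hx0 _)]
        have e : x ^ (2 * n + 1) = x ^ (1 - 2 * α) * x ^ (2 * (n:ℝ) + 2 * α) := by
          rw [← rpow_natCast, ← rpow_add hx0]; congr 1; push_cast; ring
        rw [e]
        calc _ ≤ x ^ (1 - 2 * α) * (B / (2 * n + 2 * α) * x ^ (2 * (n:ℝ) + 2 * α)) := by
              gcongr; exact hVb x hx
          _ ≤ x ^ (1 - 2 * α) * (B / (2 * α) * x ^ (2 * (n:ℝ) + 2 * α)) := by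
              gcongr
              have : (0:ℝ) ≤ n := Nat.cast_nonneg n
              linarith
          _ = _ := by ring
      · have h : Continuous (fun x : ℝ => B / ((4 * α) * (n + 1)) * x ^ (2 * (n + 1))) := by fun_prop
        have := h.tendsto 0
        simp only [ne_eq, mul_eq_zero, OfNat.ofNat_ne_zero, Nat.add_eq_zero_iff, one_ne_zero, and_false, or_self, not_false_eq_true, zero_pow, mul_zero] at this
        exact this.mono_left nhdsWithin_le_nhds
  have hlim : Tendsto (fun n : ℕ => K * ((x₀ ^ 2 / (4 * α)) ^ n / n.factorial)) atTop (𝓝 0) := by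
    simpa using (FloorSemiring.tendsto_pow_div_factorial_atTop (x₀ ^ 2 / (4 * α))).const_mul K
  have : |U x₀| ≤ 0 := by
    refine ge_of_tendsto' hlim fun n => ?_
    refine (key n x₀ ⟨hx₀, by rw [hX]; linarith⟩).trans (le_of_eq ?_)
    rw [div_pow, ← pow_mul]
    field_simp
  exact abs_nonpos_iff.1 this

lemma IsCyl.sub {C C' : ℝ → ℝ → ℝ} (h : IsCyl C) (h' : IsCyl C') :
    IsCyl (fun ν x => C ν x - C' ν x) := by
  intro ν x hx
  refine ⟨((h ν x hx).1.sub (h' ν x hx).1).congr_deriv (by ring), ?_⟩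
  have := (h ν x hx).2
  have := (h' ν x hx).2
  simp only
  linarith

lemma IsCyl.zero_shift {C : ℝ → ℝ → ℝ} (h : IsCyl C) {ν : ℝ} (h0 : ∀ x, 0 < x → C ν x = 0) :
    (∀ x, 0 < x → C (ν + 1) x = 0) ∧ (∀ x, 0 < x → C (ν - 1) x = 0) := by
  have hD : ∀ x, 0 < x → cylD C ν x = 0 := by
    intro x hx
    refine (h.hasDerivAt ν hx).unique ((hasDerivAt_const x (0:ℝ)).congr_of_eventuallyEq ?_)
    filter_upwards [lt_mem_nhds hx] with y hy using h0 y hy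
  constructor
  · intro x hx; rw [h.succ ν hx, h0 x hx, hD x hx]; simp
  · intro x hx; rw [h.pred ν hx, h0 x hx, hD x hx]; simp

lemma IsCyl.zero_int {C : ℝ → ℝ → ℝ} (h : IsCyl C) {ν : ℝ} (h0 : ∀ x, 0 < x → C ν x = 0) (n : ℤ) :
    ∀ x, 0 < x → C (ν + n) x = 0 := by
  induction n using Int.induction_on with
  | zero => simpa using h0
  | succ i ih =>
    have := (h.zero_shift ih).1
    push_cast
    rwa [← add_assoc]
  | pred i ih =>
    have := (h.zero_shift ih).2
    push_cast at this ⊢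
    rwa [← add_sub_assoc]

lemma IsCyl.zero_of_limits {C : ℝ → ℝ → ℝ} (h : IsCyl C) {ν : ℝ} (hν : -1 < ν)
    (h1 : Tendsto (fun x => x ^ (-ν) * C ν x) (𝓝[>] 0) (𝓝 0))
    (h2 : Tendsto (fun x => x ^ (ν + 1) * C (ν + 1) x) (𝓝[>] 0) (𝓝 0)) :
    ∀ x, 0 < x → C ν x = 0 := by
  have := system_zero (α := ν + 1) (by linarith) (U := fun x => x ^ (-ν) * C ν x)
    (V := fun x => x ^ (ν + 1) * C (ν + 1) x) ?_ ?_ h1 h2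
  · intro x hx
    exact (mul_eq_zero.1 (this x hx)).resolve_left (rpow_pos_of_pos hx _).ne'
  · intro x hx
    refine ((hasDerivAt_rpow_const (p := -ν) (Or.inl hx.ne')).mul (h.hasDerivAt ν hx)).congr_deriv ?_
    have hs := h.succ ν hx
    have hs' : cylD C ν x = ν / x * C ν x - C (ν + 1) x := by linarith
    rw [hs', rpow_sub_one hx.ne', ← mul_assoc, ← rpow_add hx]
    rw [show 1 - 2 * (ν + 1) + (ν + 1) = -ν by ring]
    field_simp
    ring
  · intro x hx
    refine ((hasDerivAt_rpow_const (p := ν + 1) (Or.inl hx.ne')).mul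
      (h.hasDerivAt (ν + 1) hx)).congr_deriv ?_
    rw [h.succ_D ν hx, ← mul_assoc, ← rpow_add hx, rpow_sub_one hx.ne']
    rw [show 2 * (ν + 1) - 1 + -ν = ν + 1 by ring]
    field_simp
    ring

lemma abs_intA_le (ν x : ℝ) : |intA ν x| ≤ π := by
  have := intervalIntegral.norm_integral_le_of_norm_le_const (a := 0) (b := π) (C := 1)
    (f := fun θ => cos (ν * θ - x * sin θ)) (fun θ _ => by
      rw [Real.norm_eq_abs]; exact abs_cos_le_one _)
  rw [Real.norm_eq_abs, sub_zero, abs_of_pos pi_pos, one_mul] at this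
  exact this

lemma intK_nonneg (ν x : ℝ) : 0 ≤ intK ν x :=
  MeasureTheory.integral_nonneg (fun _ => (exp_pos _).le)

lemma intK_neg_le {s : ℝ} (hs : 0 < s) {x : ℝ} (hx : 0 < x) :
    intK (-s) x ≤ ∫ t in Ioi (0 : ℝ), exp (-s * t) := by
  refine MeasureTheory.setIntegral_mono_on (integrableOn_expK (-s) hx)
    (exp_neg_integrableOn_Ioi 0 hs) measurableSet_Ioi (fun t ht => ?_)
  apply exp_le_exp.2
  have := mul_pos hx (sinh_pos_iff.2 ht)
  linarith

lemma integrableOn_expE (a : ℝ) {h : ℝ} (hh : 0 < h) :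
    MeasureTheory.IntegrableOn (fun t => exp (a * t - h * exp t)) (Ioi 0) := by
  refine MeasureTheory.Integrable.mono' (integrableOn_expK a (x := 2 * h) (by linarith))
    (by apply Continuous.aestronglyMeasurable; fun_prop) ?_
  refine Eventually.of_forall (fun t => ?_)
  rw [Real.norm_eq_abs, abs_of_pos (exp_pos _)]
  apply exp_le_exp.2
  rw [sinh_eq]
  nlinarith [mul_pos hh (exp_pos (-t))]

lemma integral_expE {a h : ℝ} (ha : 0 < a) (hh : 0 < h) :
    h ^ a * ∫ t in Ioi (0 : ℝ), exp (a * t - h * exp t)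
      = ∫ u in Ioi h, exp (-u) * u ^ (a - 1) := by
  have key : ∀ t : ℝ, ((fun u => exp (-u) * u ^ (a - 1)) ∘ fun t => h * exp t) t * (h * exp t)
      = h ^ a * exp (a * t - h * exp t) := by
    intro t
    simp only [Function.comp]
    have hp : 0 < h * exp t := mul_pos hh (exp_pos t)
    have : (h * exp t) ^ (a - 1) * (h * exp t) = h ^ a * exp (a * t) := by
      rw [rpow_sub_one hp.ne', div_mul_cancel₀ _ hp.ne', mul_rpow hh.le (exp_pos t).le,
        ← exp_mul, mul_comm t a]
    rw [mul_assoc, this, sub_eq_add_neg, exp_add]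
    ring
  have h1 := MeasureTheory.integral_comp_mul_deriv_Ioi (f := fun t => h * exp t)
    (f' := fun t => h * exp t) (g := fun u => exp (-u) * u ^ (a - 1)) (a := 0)
    (by fun_prop) (tendsto_exp_atTop.const_mul_atTop hh)
    (fun t _ => ((hasDerivAt_exp t).const_mul h).hasDerivWithinAt)
    (by
      rintro u ⟨t, _, rfl⟩
      apply ContinuousAt.continuousWithinAt
      refine ContinuousAt.mul (by fun_prop) ?_
      exact continuousAt_rpow_const _ _ (Or.inl (mul_pos hh (exp_pos t)).ne'))
    (by
      refine (Real.GammaIntegral_convergent ha).mono_set ?_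
      rintro u ⟨t, _, rfl⟩
      exact mul_pos hh (exp_pos t))
    (by
      rw [integrableOn_Ici_iff_integrableOn_Ioi]
      simp_rw [key]
      exact (integrableOn_expE a hh).const_mul _)
  simp_rw [key] at h1
  rw [MeasureTheory.integral_const_mul] at h1
  simpa using h1

lemma tendsto_incGamma {a : ℝ} (ha : 0 < a) :
    Tendsto (fun h => ∫ u in Ioi h, exp (-u) * u ^ (a - 1)) (𝓝[>] 0) (𝓝 (Gamma a)) := by
  have hGint := Real.GammaIntegral_convergent ha
  have hii : IntervalIntegrable (fun u : ℝ => exp (-u) * u ^ (a - 1)) MeasureTheory.volume 0 1 :=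
    (intervalIntegrable_iff_integrableOn_Ioc_of_le zero_le_one).2
      (hGint.mono_set (fun u hu => hu.1))
  have hc := intervalIntegral.continuousOn_primitive_interval' hii (a := 0) (by simp)
  have h0 : Tendsto (fun b => ∫ u in (0:ℝ)..b, exp (-u) * u ^ (a - 1)) (𝓝[>] 0) (𝓝 0) := by
    have := (hc 0 (by simp)).tendsto
    rw [intervalIntegral.integral_same] at this
    refine this.mono_left ?_
    rw [uIcc_of_le zero_le_one, ← nhdsWithin_Ioc_eq_nhdsGT (zero_lt_one' ℝ)]
    exact nhdsWithin_mono _ Ioc_subset_Icc_self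
  have h1 : Tendsto (fun b => Gamma a - ∫ u in (0:ℝ)..b, exp (-u) * u ^ (a - 1)) (𝓝[>] 0)
      (𝓝 (Gamma a)) := by simpa using h0.const_sub (Gamma a)
  refine h1.congr' ?_
  filter_upwards [self_mem_nhdsWithin] with h hh
  have hh : 0 < h := hh
  rw [Real.Gamma_eq_integral ha, intervalIntegral.integral_of_le hh.le,
    ← Ioc_union_Ioi_eq_Ioi hh.le, MeasureTheory.setIntegral_union
      (Ioc_disjoint_Ioi le_rfl) measurableSet_Ioi]
  · ring
  · exact hGint.mono_set (fun u hu => hu.1)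
  · exact hGint.mono_set (fun u hu => hh.trans hu)

lemma tendsto_intK {a : ℝ} (ha : 0 < a) :
    Tendsto (fun x => (x / 2) ^ a * intK a x) (𝓝[>] 0) (𝓝 (Gamma a)) := by
  have hdiv : Tendsto (fun x : ℝ => x / 2) (𝓝[>] 0) (𝓝[>] 0) := by
    refine tendsto_nhdsWithin_iff.2 ⟨?_, ?_⟩
    · have : ContinuousAt (fun x : ℝ => x / 2) 0 := by fun_prop
      simpa using this.tendsto.mono_left nhdsWithin_le_nhds
    · filter_upwards [self_mem_nhdsWithin] with x hx
      have hx : 0 < x := hx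
      exact half_pos hx
  have hI := (tendsto_incGamma ha).comp hdiv
  have hE : Tendsto (fun x : ℝ => exp (x / 2)) (𝓝[>] 0) (𝓝 1) := by
    have : ContinuousAt (fun x : ℝ => exp (x / 2)) 0 := by fun_prop
    simpa using this.tendsto.mono_left nhdsWithin_le_nhds
  have hU := hE.mul hI
  rw [one_mul] at hU
  refine tendsto_of_tendsto_of_tendsto_of_le_of_le' hI hU ?_ ?_
  · filter_upwards [self_mem_nhdsWithin] with x hx
    have hx : 0 < x := hx
    have hh : 0 < x / 2 := half_pos hx
    simp only [Function.comp]
    rw [← integral_expE ha hh]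
    refine mul_le_mul_of_nonneg_left ?_ (rpow_nonneg hh.le _)
    refine MeasureTheory.setIntegral_mono (integrableOn_expE a hh) (integrableOn_expK a hx) ?_
    intro t
    apply exp_le_exp.2
    rw [sinh_eq]
    nlinarith [mul_pos hh (exp_pos (-t))]
  · filter_upwards [self_mem_nhdsWithin] with x hx
    have hx : 0 < x := hx
    have hh : 0 < x / 2 := half_pos hx
    simp only [Function.comp]
    rw [← integral_expE ha hh, mul_left_comm, ← MeasureTheory.integral_const_mul]
    refine mul_le_mul_of_nonneg_left ?_ (rpow_nonneg hh.le _)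
    refine MeasureTheory.setIntegral_mono_on (integrableOn_expK a hx)
      ((integrableOn_expE a hh).const_mul _) measurableSet_Ioi ?_
    intro t ht
    have ht : 0 < t := ht
    rw [← exp_add]
    apply exp_le_exp.2
    rw [sinh_eq]
    have : exp (-t) ≤ 1 := exp_le_one_iff.2 (by linarith)
    nlinarith

lemma tendsto_schJ_nonpos {ν : ℝ} (h1 : -1 < ν) (h0 : ν ≤ 0) :
    Tendsto (fun x => (x / 2) ^ (-ν) * schJ ν x) (𝓝[>] 0) (𝓝 (1 / Gamma (ν + 1))) := by
  rcases h0.eq_or_lt with rfl | hneg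
  · have hc : Tendsto (intA 0) (𝓝[>] 0) (𝓝 (intA 0 0)) :=
      (continuous_intA 0).continuousAt.tendsto.mono_left nhdsWithin_le_nhds
    have hA : intA 0 0 = π := by simp [intA]
    rw [hA] at hc
    have := hc.div_const π
    rw [div_self pi_ne_zero] at this
    simpa [schJ] using this
  · have ha : 0 < -ν := by linarith
    have hp : Tendsto (fun x : ℝ => (x / 2) ^ (-ν)) (𝓝[>] 0) (𝓝 0) := by
      have := tendsto_const_rpow ha ((1/2) ^ (-ν))
      refine this.congr' ?_
      filter_upwards [self_mem_nhdsWithin] with x hx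
      have hx : 0 < x := hx
      rw [← mul_rpow (by norm_num) hx.le]
      congr 1; ring
    have hA : Tendsto (fun x : ℝ => (x / 2) ^ (-ν) * intA ν x) (𝓝[>] 0) (𝓝 0) := by
      have hc : Tendsto (intA ν) (𝓝[>] 0) (𝓝 (intA ν 0)) :=
        (continuous_intA ν).continuousAt.tendsto.mono_left nhdsWithin_le_nhds
      simpa using hp.mul hc
    have hK := tendsto_intK ha
    have := (hA.sub (hK.const_mul (sin (ν * π)))).div_const π
    have hlim : (0 - sin (ν * π) * Gamma (-ν)) / π = 1 / Gamma (ν + 1) := by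
      have hr := Real.Gamma_mul_Gamma_one_sub (-ν)
      have hG : Gamma (ν + 1) ≠ 0 := (Gamma_pos_of_pos (by linarith)).ne'
      have hs : sin (ν * π) ≠ 0 := by
        have : 0 < sin (-(ν * π)) := by
          apply sin_pos_of_pos_of_lt_pi <;> nlinarith [pi_pos]
        rw [sin_neg] at this
        linarith
      have e1 : 1 - -ν = ν + 1 := by ring
      have e2 : sin (π * -ν) = -sin (ν * π) := by rw [← sin_neg]; congr 1; ring
      rw [e1, e2] at hr
      field_simp at hr ⊢
      linarith
    rw [hlim] at this
    refine this.congr (fun x => ?_)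
    simp only [schJ]
    ring

lemma besselJ_eq_schJ_base {ν : ℝ} (h1 : -1 < ν) (h0 : ν ≤ 0) :
    ∀ x, 0 < x → besselJ ν x - schJ ν x = 0 := by
  refine (isCyl_besselJ.sub isCyl_schJ).zero_of_limits h1 ?_ ?_
  · have hJ : Tendsto (fun x => (x / 2) ^ (-ν) * besselJ ν x) (𝓝[>] 0)
        (𝓝 (1 / Gamma (ν + 1))) := by
      refine (tendsto_phi ν).congr' ?_
      filter_upwards [self_mem_nhdsWithin] with x hx
      have hx : 0 < x := hx
      rw [besselJ_eq ν hx, ← mul_assoc, ← rpow_add (half_pos hx)]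
      simp
    have := ((hJ.sub (tendsto_schJ_nonpos h1 h0)).const_mul (2 ^ (-ν)))
    rw [sub_self, mul_zero] at this
    refine this.congr' ?_
    filter_upwards [self_mem_nhdsWithin] with x hx
    have hx : 0 < x := hx
    have e : x ^ (-ν) = 2 ^ (-ν) * (x / 2) ^ (-ν) := by
      rw [← mul_rpow (by norm_num) (half_pos hx).le]; congr 1; ring
    rw [e]; ring
  · have hs : 0 < ν + 1 := by linarith
    have hx0 : Tendsto (fun x : ℝ => x ^ (ν + 1)) (𝓝[>] 0) (𝓝 0) := by
      simpa using tendsto_const_rpow hs 1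
    have hx1 : Tendsto (fun x : ℝ => (x / 2) ^ (ν + 1)) (𝓝[>] 0) (𝓝 0) := by
      have := tendsto_const_rpow hs ((1/2) ^ (ν + 1))
      refine this.congr' ?_
      filter_upwards [self_mem_nhdsWithin] with x hx
      have hx : 0 < x := hx
      rw [← mul_rpow (by norm_num) hx.le]
      congr 1; ring
    have hJ : Tendsto (fun x => x ^ (ν + 1) * besselJ (ν + 1) x) (𝓝[>] 0) (𝓝 0) := by
      have := hx0.mul (hx1.mul (tendsto_phi (ν + 1)))
      simp only [zero_mul] at this
      refine this.congr' ?_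
      filter_upwards [self_mem_nhdsWithin] with x hx
      have hx : 0 < x := hx
      rw [besselJ_eq (ν + 1) hx]
    have hS : Tendsto (fun x => x ^ (ν + 1) * schJ (ν + 1) x) (𝓝[>] 0) (𝓝 0) := by
      set M := (π + ∫ t in Ioi (0 : ℝ), exp (-(ν + 1) * t)) / π with hM
      refine squeeze_zero_norm' (a := fun x => x ^ (ν + 1) * M) ?_ ?_
      · filter_upwards [self_mem_nhdsWithin] with x hx
        have hx : 0 < x := hx
        rw [norm_mul, Real.norm_eq_abs, Real.norm_eq_abs, abs_of_nonneg (rpow_nonneg hx.le _)]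
        refine mul_le_mul_of_nonneg_left ?_ (rpow_nonneg hx.le _)
        rw [schJ, abs_div, abs_of_pos pi_pos, hM]
        refine div_le_div_of_nonneg_right ?_ pi_pos.le
        refine (abs_sub _ _).trans (add_le_add (abs_intA_le _ _) ?_)
        rw [abs_mul, abs_of_nonneg (intK_nonneg _ _)]
        calc _ ≤ 1 * intK (-(ν + 1)) x :=
              mul_le_mul_of_nonneg_right (abs_sin_le_one _) (intK_nonneg _ _)
          _ ≤ _ := by rw [one_mul]; exact intK_neg_le hs hx
      · simpa using hx0.mul_const M
    have := hJ.sub hS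
    rw [sub_zero] at this
    refine this.congr (fun x => ?_)
    ring

lemma besselJ_eq_schJ (ν x : ℝ) (hx : 0 < x) : besselJ ν x = schJ ν x := by
  have h1 : -1 < ν - ⌈ν⌉ := by linarith [Int.ceil_lt_add_one ν]
  have h0 : ν - ⌈ν⌉ ≤ 0 := by linarith [Int.le_ceil ν]
  have := (isCyl_besselJ.sub isCyl_schJ).zero_int (besselJ_eq_schJ_base h1 h0) ⌈ν⌉ x hx
  simp only [sub_add_cancel] at this
  linarith

lemma IsCyl.hasDerivAt_xD {C : ℝ → ℝ → ℝ} (h : IsCyl C) (ν : ℝ) {x : ℝ} (hx : 0 < x) :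
    HasDerivAt (fun x => x * cylD C ν x) ((ν ^ 2 - x ^ 2) / x * C ν x) x := by
  have := (hasDerivAt_id x).mul (h.hasDerivAt_D ν hx)
  refine this.congr_deriv ?_
  simp only [id]
  field_simp
  ring

lemma besselJ_pos_aux {ν : ℝ} (hν : 0 < ν) :
    (∀ᶠ x in 𝓝[>] 0, 0 < besselJ ν x) ∧
      Tendsto (fun x => x * cylD besselJ ν x) (𝓝[>] 0) (𝓝 0) := by
  have hx1 : ∀ μ : ℝ, 0 < μ → Tendsto (fun x : ℝ => (x / 2) ^ μ) (𝓝[>] 0) (𝓝 0) := by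
    intro μ hμ
    have := tendsto_const_rpow hμ ((1/2) ^ μ)
    refine this.congr' ?_
    filter_upwards [self_mem_nhdsWithin] with x hx
    have hx : 0 < x := hx
    rw [← mul_rpow (by norm_num) hx.le]
    congr 1; ring
  have hJ : ∀ μ : ℝ, 0 < μ → Tendsto (besselJ μ) (𝓝[>] 0) (𝓝 0) := by
    intro μ hμ
    have := (hx1 μ hμ).mul (tendsto_phi μ)
    rw [zero_mul] at this
    refine this.congr' ?_
    filter_upwards [self_mem_nhdsWithin] with x hx
    rw [besselJ_eq μ hx]
  constructor
  · have hG : 0 < 1 / Gamma (ν + 1) := one_div_pos.2 (Gamma_pos_of_pos (by linarith))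
    filter_upwards [(tendsto_phi ν).eventually (lt_mem_nhds hG), self_mem_nhdsWithin] with x h1 hx
    have hx : 0 < x := hx
    rw [besselJ_eq ν hx]
    exact mul_pos (rpow_pos_of_pos (half_pos hx) _) h1
  · have hid : Tendsto (fun x : ℝ => x) (𝓝[>] 0) (𝓝 0) := nhdsWithin_le_nhds
    have := ((hJ ν hν).const_mul ν).sub (hid.mul (hJ (ν + 1) (by linarith)))
    simp only [mul_zero, sub_zero] at this
    refine this.congr' ?_
    filter_upwards [self_mem_nhdsWithin] with x hx
    have hx : 0 < x := hx
    rw [isCyl_besselJ.succ ν hx]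
    field_simp
    ring

lemma besselJ_pos {ν : ℝ} (hν : 0 < ν) :
    (∀ x ∈ Ioc 0 ν, 0 < besselJ ν x) ∧ ∀ x ∈ Ioc 0 ν, 0 < cylD besselJ ν x := by
  obtain ⟨hev, hlim⟩ := besselJ_pos_aux hν
  have h := isCyl_besselJ
  have hpos : ∀ x ∈ Ioc 0 ν, 0 < besselJ ν x := by
    intro b hb
    by_contra hneg
    have hneg : besselJ ν b ≤ 0 := not_lt.1 hneg
    obtain ⟨δ, hδ, hδ'⟩ := mem_nhdsGT_iff_exists_Ioo_subset.1 hev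
    have hδ : 0 < δ := hδ
    have hm : 0 < min δ b := lt_min hδ hb.1
    set a := min δ b / 2 with ha
    have ha0 : 0 < a := half_pos hm
    have haδ : a < δ := lt_of_lt_of_le (half_lt_self hm) (min_le_left _ _)
    have hab : a < b := lt_of_lt_of_le (half_lt_self hm) (min_le_right _ _)
    obtain ⟨c, hc, hc0, hcp⟩ := exists_first_zero (f := besselJ ν) hab.le
      (fun x hx => (h.hasDerivAt ν (ha0.trans_le hx.1)).continuousAt.continuousWithinAt)
      (hδ' ⟨ha0, haδ⟩) hneg
    have hall : ∀ x ∈ Ioo 0 c, 0 < besselJ ν x := by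
      intro x hx
      rcases lt_or_ge x a with h1 | h1
      · exact hδ' ⟨hx.1, h1.trans haδ⟩
      · exact hcp x ⟨h1, hx.2⟩
    have hg := nonneg_of_deriv_nonneg (h := fun x => x * cylD besselJ ν x)
      (h' := fun x => (ν ^ 2 - x ^ 2) / x * besselJ ν x) (X := c)
      (fun x hx => h.hasDerivAt_xD ν hx.1)
      (fun x hx => by
        have : x < ν := hx.2.trans_le (hc.2.trans hb.2)
        have h2 : 0 ≤ ν ^ 2 - x ^ 2 := by nlinarith [hx.1]
        exact mul_nonneg (div_nonneg h2 hx.1.le) (hall x hx).le) hlim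
    have hmono : MonotoneOn (besselJ ν) (Icc a c) := by
      refine monotoneOn_of_deriv_nonneg (convex_Icc a c)
        (fun x hx => (h.hasDerivAt ν (ha0.trans_le hx.1)).continuousAt.continuousWithinAt) ?_ ?_
      · intro x hx
        rw [interior_Icc] at hx
        exact (h.hasDerivAt ν (ha0.trans hx.1)).differentiableAt.differentiableWithinAt
      · intro x hx
        rw [interior_Icc] at hx
        have hx0 := ha0.trans hx.1
        rw [(h.hasDerivAt ν hx0).deriv]
        have := hg x ⟨hx0, hx.2⟩
        exact nonneg_of_mul_nonneg_right this hx0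
    have h1 := hmono ⟨le_rfl, hc.1.le⟩ ⟨hc.1.le, le_rfl⟩ hc.1.le
    have h2 := hδ' ⟨ha0, haδ⟩
    have h2 : 0 < besselJ ν a := h2
    linarith
  refine ⟨hpos, fun x hx => ?_⟩
  have hg := nonneg_of_deriv_nonneg (h := fun x => x * cylD besselJ ν x)
      (h' := fun x => (ν ^ 2 - x ^ 2) / x * besselJ ν x) (X := ν)
      (fun x hx => h.hasDerivAt_xD ν hx.1)
      (fun x hx => by
        have h2 : 0 ≤ ν ^ 2 - x ^ 2 := by nlinarith [hx.1, hx.2]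
        exact mul_nonneg (div_nonneg h2 hx.1.le) (hpos x ⟨hx.1, hx.2.le⟩).le) hlim
  have hsm : StrictMonoOn (fun x => x * cylD besselJ ν x) (Icc (x / 2) x) := by
    have hx2 : 0 < x / 2 := half_pos hx.1
    refine strictMonoOn_of_deriv_pos (convex_Icc _ _)
      (fun y hy => (h.hasDerivAt_xD ν (hx2.trans_le hy.1)).continuousAt.continuousWithinAt) ?_
    intro y hy
    rw [interior_Icc] at hy
    have hy0 : 0 < y := hx2.trans hy.1
    have hyν : y < ν := hy.2.trans_le hx.2
    rw [(h.hasDerivAt_xD ν hy0).deriv]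
    have h2 : 0 < ν ^ 2 - y ^ 2 := by nlinarith
    exact mul_pos (div_pos h2 hy0) (hpos y ⟨hy0, hyν.le⟩)
  have hx2 : x / 2 < x := half_lt_self hx.1
  have h1 := hsm ⟨le_rfl, hx2.le⟩ ⟨hx2.le, le_rfl⟩ hx2
  have h2 := hg (x / 2) ⟨half_pos hx.1, hx2.trans_le hx.2⟩
  have h1 : x / 2 * cylD besselJ ν (x / 2) < x * cylD besselJ ν x := h1
  have h2 : 0 ≤ x / 2 * cylD besselJ ν (x / 2) := h2
  exact pos_of_mul_pos_right (h2.trans_lt h1) hx.1.le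

lemma intB_nonneg {ν x : ℝ} (hx : 0 < x) (hxν : x < ν) : 0 ≤ intB ν x := by
  have hden : ∀ θ : ℝ, 0 < ν - x * cos θ := by
    intro θ
    nlinarith [cos_le_one θ]
  have hd : ∀ θ : ℝ, HasDerivAt (fun θ => (1 - cos (ν * θ - x * sin θ)) / (ν - x * cos θ))
      (sin (ν * θ - x * sin θ) - (1 - cos (ν * θ - x * sin θ)) * (x * sin θ) / (ν - x * cos θ) ^ 2)
      θ := by
    intro θ
    have h1 : HasDerivAt (fun θ => ν - x * cos θ) (x * sin θ) θ :=
      (((hasDerivAt_cos θ).const_mul x).const_sub ν).congr_deriv (by ring)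
    have h2 := ((hasDerivAt_phase ν x θ).cos.const_sub 1).div h1 (hden θ).ne'
    refine h2.congr_deriv ?_
    have := (hden θ).ne'
    field_simp
  have := intervalIntegral.sub_le_integral_of_hasDeriv_right_of_le (a := 0) (b := π)
    (φ := fun θ => sin (ν * θ - x * sin θ)) pi_pos.le
    (fun θ _ => (hd θ).continuousAt.continuousWithinAt)
    (fun θ _ => (hd θ).hasDerivWithinAt)
    (Continuous.integrableOn_Icc (by fun_prop))
    (fun θ hθ => by
      have h1 : 0 ≤ (1 - cos (ν * θ - x * sin θ)) * (x * sin θ) / (ν - x * cos θ) ^ 2 := by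
        refine div_nonneg (mul_nonneg ?_ (mul_nonneg hx.le (sin_pos_of_mem_Ioo hθ).le)) (sq_nonneg _)
        linarith [cos_le_one (ν * θ - x * sin θ)]
      linarith)
  have e0 : (1 - cos (ν * 0 - x * sin 0)) / (ν - x * cos 0) = 0 := by simp
  have e1 : 0 ≤ (1 - cos (ν * π - x * sin π)) / (ν - x * cos π) :=
    div_nonneg (by linarith [cos_le_one (ν * π - x * sin π)]) (hden π).le
  have h3 : intB ν x = ∫ θ in (0:ℝ)..π, sin (ν * θ - x * sin θ) := rfl
  rw [h3]
  linarith

lemma setIntegral_Ioi_pos {f : ℝ → ℝ} (hi : MeasureTheory.IntegrableOn f (Ioi 0))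
    (hp : ∀ t, 0 < t → 0 < f t) : 0 < ∫ t in Ioi (0:ℝ), f t := by
  rw [MeasureTheory.setIntegral_pos_iff_support_of_nonneg_ae _ hi]
  · have : Function.support f ∩ Ioi 0 = Ioi 0 := by
      ext t
      simp only [mem_inter_iff, Function.mem_support, mem_Ioi, and_iff_right_iff_imp]
      intro ht
      exact (hp t ht).ne'
    rw [this]
    simp
  · refine (MeasureTheory.ae_restrict_iff' measurableSet_Ioi).2 (Eventually.of_forall ?_)
    intro t ht
    exact (hp t ht).le

lemma intK_lt {ν x : ℝ} (hν : 0 < ν) (hx : 0 < x) : intK (-ν) x < intK ν x := by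
  have h1 := integrableOn_expK ν hx
  have h2 := integrableOn_expK (-ν) hx
  have := setIntegral_Ioi_pos (h1.sub h2) (fun t ht => by
    simp only [Pi.sub_apply, sub_pos]
    apply exp_lt_exp.2
    nlinarith)
  rw [MeasureTheory.integral_sub' h1 h2] at this
  simp only [intK]
  linarith

lemma add_cos_mul_pos {a b : ℝ} (θ : ℝ) (hb : 0 ≤ b) (hab : b < a) : 0 < a + cos θ * b := by
  nlinarith [neg_one_le_cos θ]

lemma schY_neg {ν x : ℝ} (hx : 0 < x) (hxν : x < ν) : schY ν x < 0 := by
  have h1 := intB_nonneg hx hxν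
  have h2 := add_cos_mul_pos (ν * π) (intK_nonneg (-ν) x) (intK_lt (hx.trans hxν) hx)
  unfold schY
  refine div_neg_of_neg_of_pos ?_ pi_pos
  linarith

lemma diffK_eq (ν : ℝ) {x : ℝ} (hx : 0 < x) : intK (ν + 1) x - intK (ν - 1) x
    = ∫ t in Ioi (0:ℝ), (exp ((ν + 1) * t - x * sinh t) - exp ((ν - 1) * t - x * sinh t)) := by
  rw [MeasureTheory.integral_sub (integrableOn_expK _ hx) (integrableOn_expK _ hx)]
  rfl

lemma expK_diff (ν x t : ℝ) : exp ((ν + 1) * t - x * sinh t) - exp ((ν - 1) * t - x * sinh t)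
    = exp (ν * t) * (2 * sinh t * exp (- (x * sinh t))) := by
  have e1 : (ν + 1) * t - x * sinh t = ν * t + t + -(x * sinh t) := by ring
  have e2 : (ν - 1) * t - x * sinh t = ν * t + -t + -(x * sinh t) := by ring
  rw [e1, e2, exp_add, exp_add, exp_add (ν * t + -t), exp_add (ν * t) (-t), sinh_eq]
  ring

lemma diffK_pos (ν : ℝ) {x : ℝ} (hx : 0 < x) : 0 < intK (ν + 1) x - intK (ν - 1) x := by
  rw [diffK_eq ν hx]
  refine setIntegral_Ioi_pos ((integrableOn_expK _ hx).sub (integrableOn_expK _ hx)) ?_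
  intro t ht
  rw [expK_diff]
  have := sinh_pos_iff.2 ht
  positivity

lemma diffK_lt {ν x : ℝ} (hν : 0 < ν) (hx : 0 < x) :
    intK (-ν + 1) x - intK (-ν - 1) x < intK (ν + 1) x - intK (ν - 1) x := by
  rw [← sub_pos, diffK_eq ν hx, diffK_eq (-ν) hx]
  have i1 := (integrableOn_expK (ν + 1) hx).sub (integrableOn_expK (ν - 1) hx)
  have i2 := (integrableOn_expK (-ν + 1) hx).sub (integrableOn_expK (-ν - 1) hx)
  have := setIntegral_Ioi_pos (i1.sub i2) (fun t ht => by
    simp only [Pi.sub_apply]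
    rw [expK_diff, expK_diff, ← sub_mul]
    have h1 := sinh_pos_iff.2 ht
    have h2 : 0 < exp (ν * t) - exp (-ν * t) := sub_pos.2 (exp_lt_exp.2 (by nlinarith))
    positivity)
  rw [MeasureTheory.integral_sub' i1 i2] at this
  exact this

lemma cylD_schY (ν : ℝ) {x : ℝ} (hx : 0 < x) : cylD schY ν x =
    ((∫ θ in (0:ℝ)..π, cos (ν * θ - x * sin θ) * sin θ)
      + ((intK (ν + 1) x - intK (ν - 1) x)
        + cos (ν * π) * (intK (-ν + 1) x - intK (-ν - 1) x)) / 2) / π := by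
  have h1 := isCyl_schY.hasDerivAt ν hx
  have h2 := (((hasDerivAt_intB ν x).neg.sub (hasDerivAt_intK ν hx)).sub
    ((hasDerivAt_intK (-ν) hx).const_mul (cos (ν * π)))).div_const π
  refine (h1.unique h2).trans ?_
  ring

/-- Auxiliary comparison function for the sign of the derivative at the turning point. -/
noncomputable def auxG (ν θ : ℝ) : ℝ :=
  cos (θ / 2) / sin (θ / 2) * (sin (ν * θ - ν * sin θ) / ν)
    + (1 - cos (ν * θ - ν * sin θ)) / (4 * ν ^ 2 * sin (θ / 2) ^ 4)

lemma hasDerivAt_auxG {ν θ : ℝ} (hν : 0 < ν) (hθ0 : 0 < θ) (hθ : θ < 2 * π) :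
    HasDerivAt (auxG ν) (cos (ν * θ - ν * sin θ) * sin θ
      - (1 - cos (ν * θ - ν * sin θ)) * cos (θ / 2) / (2 * ν ^ 2 * sin (θ / 2) ^ 5)) θ := by
  have hs : 0 < sin (θ / 2) := sin_pos_of_pos_of_lt_pi (by linarith) (by linarith)
  have hhalf : HasDerivAt (fun θ : ℝ => θ / 2) (1 / 2) θ := (hasDerivAt_id θ).div_const 2
  have hP := hasDerivAt_phase ν ν θ
  have hS := hhalf.sin
  have hC := hhalf.cos
  have h1 := (hC.div hS hs.ne').mul (hP.sin.div_const ν)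
  have h2 := (hP.cos.const_sub 1).div ((hS.pow 4).const_mul (4 * ν ^ 2))
    (by simp only [Pi.pow_apply]; positivity)
  refine (h1.add h2).congr_deriv ?_
  have e1 : sin θ = 2 * sin (θ / 2) * cos (θ / 2) := by
    rw [← sin_two_mul]; congr 1; ring
  have e2 : cos θ = 1 - 2 * sin (θ / 2) ^ 2 := by
    have := cos_two_mul (θ / 2)
    rw [show 2 * (θ / 2) = θ by ring] at this
    rw [this, cos_sq']; ring
  have e3 : cos (θ / 2) ^ 2 = 1 - sin (θ / 2) ^ 2 := cos_sq' _
  rw [e2]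
  generalize hw : ν * θ - ν * sin θ = w
  rw [e1]
  simp only [Pi.div_apply, Pi.pow_apply]
  generalize sin (θ / 2) = s at *
  generalize cos (θ / 2) = c at *
  field_simp
  ring_nf
  have e4 : c ^ 2 = 1 - s ^ 2 := e3
  try rw [e4]
  try ring

lemma auxG_bound {ν θ : ℝ} (hν : 0 < ν) (h0 : 0 ≤ θ) (h1 : θ ≤ 1) :
    |auxG ν θ| ≤ (π + π ^ 4) * θ ^ 2 := by
  rcases h0.eq_or_lt with rfl | h0
  · simp [auxG]
  have hpi := pi_gt_three
  have hs : θ / π ≤ sin (θ / 2) := by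
    have := mul_le_sin (x := θ / 2) (by linarith) (by linarith)
    refine le_trans (le_of_eq ?_) this
    field_simp
  have hs0 : 0 < θ / π := by positivity
  have hs1 : 0 < sin (θ / 2) := hs0.trans_le hs
  set u := θ - sin θ with hu
  have hu0 : 0 ≤ u := by linarith [sin_lt h0]
  have hu1 : u ≤ θ ^ 3 := by
    have := sin_gt_sub_cube h0
    have h3 : 0 < θ ^ 3 := by positivity
    linarith
  have hw : ν * θ - ν * sin θ = ν * u := by rw [hu]; ring
  have b1 : |cos (θ / 2) / sin (θ / 2) * (sin (ν * u) / ν)| ≤ π * θ ^ 2 := by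
    have hA : |cos (θ / 2) / sin (θ / 2)| ≤ 1 / (θ / π) := by
      rw [abs_div, abs_of_pos hs1]
      exact div_le_div₀ zero_le_one (abs_cos_le_one _) hs0 hs
    have hB : |sin (ν * u) / ν| ≤ θ ^ 3 := by
      rw [abs_div, abs_of_pos hν, div_le_iff₀ hν]
      have := abs_sin_le_abs (x := ν * u)
      rw [abs_of_nonneg (mul_nonneg hν.le hu0)] at this
      nlinarith
    rw [abs_mul]
    calc _ ≤ 1 / (θ / π) * θ ^ 3 := mul_le_mul hA hB (abs_nonneg _) (by positivity)
      _ = _ := by field_simp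
  have b2 : |(1 - cos (ν * u)) / (4 * ν ^ 2 * sin (θ / 2) ^ 4)| ≤ π ^ 4 * θ ^ 2 := by
    have hc : 0 ≤ 1 - cos (ν * u) := by linarith [cos_le_one (ν * u)]
    have hc2 : 1 - cos (ν * u) ≤ 4 * ν ^ 2 * (θ ^ 3) ^ 2 := by
      have := one_sub_sq_div_two_le_cos (x := ν * u)
      have h5 : u ^ 2 ≤ (θ ^ 3) ^ 2 := pow_le_pow_left₀ hu0 hu1 2
      have h6 : ν ^ 2 * u ^ 2 ≤ ν ^ 2 * (θ ^ 3) ^ 2 := mul_le_mul_of_nonneg_left h5 (sq_nonneg _)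
      have h7 : 0 ≤ ν ^ 2 * (θ ^ 3) ^ 2 := by positivity
      nlinarith
    rw [abs_of_nonneg (div_nonneg hc (by positivity))]
    calc _ ≤ 4 * ν ^ 2 * (θ ^ 3) ^ 2 / (4 * ν ^ 2 * (θ / π) ^ 4) := by
          refine div_le_div₀ (by positivity) hc2 (by positivity) ?_
          gcongr
      _ = _ := by field_simp
  unfold auxG
  rw [hw]
  refine (abs_add_le _ _).trans ?_
  linarith

lemma continuousOn_auxG {ν : ℝ} (hν : 0 < ν) : ContinuousOn (auxG ν) (Icc 0 π) := by
  intro θ hθ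
  rcases hθ.1.eq_or_lt with rfl | h0
  · have h00 : auxG ν 0 = 0 := by simp [auxG]
    unfold ContinuousWithinAt
    rw [h00]
    have hl : Tendsto (fun θ : ℝ => (π + π ^ 4) * θ ^ 2) (𝓝[Icc 0 π] 0) (𝓝 0) := by
      have : ContinuousAt (fun θ : ℝ => (π + π ^ 4) * θ ^ 2) 0 := by fun_prop
      simpa using this.tendsto.mono_left nhdsWithin_le_nhds
    refine squeeze_zero_norm' ?_ hl
    filter_upwards [self_mem_nhdsWithin, mem_nhdsWithin_of_mem_nhds (Iio_mem_nhds zero_lt_one)]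
      with y hy hy1
    exact auxG_bound hν hy.1 (le_of_lt hy1)
  · exact (hasDerivAt_auxG hν h0 (by linarith [hθ.2, pi_pos])).continuousAt.continuousWithinAt

lemma turning_integral_nonneg {ν : ℝ} (hν : 0 < ν) :
    0 ≤ ∫ θ in (0:ℝ)..π, cos (ν * θ - ν * sin θ) * sin θ := by
  have := intervalIntegral.sub_le_integral_of_hasDeriv_right_of_le (a := 0) (b := π)
    (g := auxG ν) (φ := fun θ => cos (ν * θ - ν * sin θ) * sin θ) pi_pos.le
    (continuousOn_auxG hν)
    (fun θ hθ => (hasDerivAt_auxG hν hθ.1 (by linarith [hθ.2, pi_pos])).hasDerivWithinAt)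
    (Continuous.integrableOn_Icc (by fun_prop))
    (fun θ hθ => by
      have hs : 0 < sin (θ / 2) :=
        sin_pos_of_pos_of_lt_pi (by linarith [hθ.1]) (by linarith [hθ.2, hθ.1])
      have hc : 0 ≤ cos (θ / 2) :=
        cos_nonneg_of_mem_Icc ⟨by linarith [hθ.1, pi_pos], by linarith [hθ.2]⟩
      have h1 : 0 ≤ 1 - cos (ν * θ - ν * sin θ) := by linarith [cos_le_one (ν * θ - ν * sin θ)]
      have : 0 ≤ (1 - cos (ν * θ - ν * sin θ)) * cos (θ / 2) / (2 * ν ^ 2 * sin (θ / 2) ^ 5) := by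
        positivity
      linarith)
  have h00 : auxG ν 0 = 0 := by simp [auxG]
  have h1 : 0 ≤ auxG ν π := by
    simp only [auxG, sin_pi, cos_pi_div_two, sin_pi_div_two, zero_div, zero_mul, zero_add]
    have : 0 ≤ 1 - cos (ν * π - ν * 0) := by linarith [cos_le_one (ν * π - ν * 0)]
    positivity
  linarith

lemma cylD_schY_self_pos {ν : ℝ} (hν : 0 < ν) : 0 < cylD schY ν ν := by
  rw [cylD_schY ν hν]
  have h1 := turning_integral_nonneg hν
  have h2 := add_cos_mul_pos (ν * π) (diffK_pos (-ν) hν).le (diffK_lt hν hν)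
  refine div_pos ?_ pi_pos
  linarith

lemma cylD_schY_pos {ν : ℝ} (hν : 0 < ν) : ∀ x ∈ Ioc 0 ν, 0 < cylD schY ν x := by
  intro x hx
  have h := isCyl_schY
  have hanti : AntitoneOn (fun x => x * cylD schY ν x) (Icc x ν) := by
    refine antitoneOn_of_deriv_nonpos (convex_Icc _ _)
      (fun y hy => (h.hasDerivAt_xD ν (hx.1.trans_le hy.1)).continuousAt.continuousWithinAt) ?_ ?_
    · intro y hy
      rw [interior_Icc] at hy
      exact (h.hasDerivAt_xD ν (hx.1.trans hy.1)).differentiableAt.differentiableWithinAt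
    · intro y hy
      rw [interior_Icc] at hy
      have hy0 := hx.1.trans hy.1
      rw [(h.hasDerivAt_xD ν hy0).deriv]
      have h2 : 0 ≤ ν ^ 2 - y ^ 2 := by nlinarith [hy.2]
      exact mul_nonpos_of_nonneg_of_nonpos (div_nonneg h2 hy0.le) (schY_neg hy0 hy.2).le
  have h1 := hanti ⟨le_rfl, hx.2⟩ ⟨hx.2, le_rfl⟩ hx.2
  have h1 : ν * cylD schY ν ν ≤ x * cylD schY ν x := h1
  have h2 := mul_pos hν (cylD_schY_self_pos hν)
  exact pos_of_mul_pos_right (h2.trans_le h1) hx.1.le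

lemma wronskian_pos {ν : ℝ} (hν : 0 < ν) {x : ℝ} (hx : 0 < x) :
    0 < besselJ ν x * (x * cylD schY ν x) - x * cylD besselJ ν x * schY ν x := by
  have hd : ∀ y, 0 < y → HasDerivAt
      (fun x => besselJ ν x * (x * cylD schY ν x) - x * cylD besselJ ν x * schY ν x) 0 y := by
    intro y hy
    have := ((isCyl_besselJ.hasDerivAt ν hy).mul (isCyl_schY.hasDerivAt_xD ν hy)).sub
      ((isCyl_besselJ.hasDerivAt_xD ν hy).mul (isCyl_schY.hasDerivAt ν hy))
    exact this.congr_deriv (by ring)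
  have hconst := (convex_Ioi (0:ℝ)).is_const_of_fderivWithin_eq_zero (𝕜 := ℝ)
    (f := fun x => besselJ ν x * (x * cylD schY ν x) - x * cylD besselJ ν x * schY ν x)
    (fun y hy => (hd y hy).differentiableAt.differentiableWithinAt)
    (fun y hy => by
      rw [fderivWithin_of_isOpen isOpen_Ioi hy]
      have := (hd y hy).hasFDerivAt.fderiv
      rw [this]
      ext
      simp)
    (show x ∈ Ioi 0 from hx) (show ν / 2 ∈ Ioi 0 from half_pos hν)
  rw [hconst]
  have h2 : ν / 2 ∈ Ioc 0 ν := ⟨half_pos hν, by linarith⟩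
  have a1 := (besselJ_pos hν).1 _ h2
  have a2 := (besselJ_pos hν).2 _ h2
  have a3 := cylD_schY_pos hν _ h2
  have a4 := schY_neg (ν := ν) (half_pos hν) (by linarith)
  have b1 := mul_pos a1 (mul_pos (half_pos hν) a3)
  have b2 := mul_neg_of_pos_of_neg (mul_pos (half_pos hν) a2) a4
  linarith

lemma interlaced_congr {f g f₁ g₁ : ℝ → ℝ} (hf : ∀ x, 0 < x → f x = f₁ x)
    (hg : ∀ x, 0 < x → g x = g₁ x) (h : InterlacedOn f₁ g₁ (Ioi 0)) :
    InterlacedOn f g (Ioi 0) := by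
  have key : ∀ {f g f₁ g₁ : ℝ → ℝ}, (∀ x, 0 < x → f x = f₁ x) →
      (∀ x, 0 < x → g x = g₁ x) → InterlaceHalf f₁ g₁ (Ioi 0) → InterlaceHalf f g (Ioi 0) := by
    intro f g f₁ g₁ hf hg h x₁ h₁ x₂ h₂ hlt e₁ e₂ hno
    have h₁ : 0 < x₁ := h₁
    have h₂ : 0 < x₂ := h₂
    rw [hf _ h₁] at e₁
    rw [hf _ h₂] at e₂
    obtain ⟨z, ⟨hz, hz0⟩, hu⟩ := h x₁ h₁ x₂ h₂ hlt e₁ e₂ (fun x hx => by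
      rw [← hf x (h₁.trans hx.1)]; exact hno x hx)
    refine ⟨z, ⟨hz, by rw [hg z (h₁.trans hz.1)]; exact hz0⟩, ?_⟩
    rintro y ⟨hy, hy0⟩
    exact hu y ⟨hy, by rw [← hg y (h₁.trans hy.1)]; exact hy0⟩
  exact ⟨key hf hg h.1, key hg hf h.2⟩

lemma deriv_besselY (ν : ℝ) {x : ℝ} (hx : 0 < x) : deriv (besselY ν) x = cylD schY ν x := by
  have he : besselY ν =ᶠ[𝓝 x] schY ν := by
    filter_upwards [Ioi_mem_nhds hx] with y hy
    exact besselY_eq_schY besselJ_eq_schJ ν hy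
  rw [he.deriv_eq]
  exact (isCyl_schY.hasDerivAt ν hx).deriv

/-- For `ν > 0`, the positive zeros of `J_ν′` and `J_{ν+2}′` are interlaced on `(0,∞)`,
and so are those of `Y_ν′` and `Y_{ν+2}′`. -/
theorem bessel_deriv_interlaced_add_two (ν : ℝ) (hν : 0 < ν) :
    InterlacedOn (deriv (besselJ ν)) (deriv (besselJ (ν + 2))) (Set.Ioi 0) ∧
      InterlacedOn (deriv (besselY ν)) (deriv (besselY (ν + 2))) (Set.Ioi 0) := by
  have hν2 : 0 < ν + 2 := by linarith
  have hneJ : ∀ μ : ℝ, 0 < μ → ∀ x, 0 < x → cylD besselJ μ x = 0 → besselJ μ x ≠ 0 := by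
    intro μ hμ x hx h1 h2
    have := wronskian_pos hμ hx
    rw [h1, h2] at this
    simp at this
  have hneY : ∀ μ : ℝ, 0 < μ → ∀ x, 0 < x → cylD schY μ x = 0 → schY μ x ≠ 0 := by
    intro μ hμ x hx h1 h2
    have := wronskian_pos hμ hx
    rw [h1, h2] at this
    simp at this
  constructor
  · exact interlaced_congr (fun x hx => (isCyl_besselJ.hasDerivAt ν hx).deriv)
      (fun x hx => (isCyl_besselJ.hasDerivAt (ν + 2) hx).deriv)
      (isCyl_besselJ.interlaced hν (besselJ_pos hν).2 (besselJ_pos hν2).2 (hneJ ν hν)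
        (hneJ _ hν2))
  · exact interlaced_congr (fun x hx => deriv_besselY ν hx) (fun x hx => deriv_besselY (ν + 2) hx)
      (isCyl_schY.interlaced hν (cylD_schY_pos hν) (cylD_schY_pos hν2) (hneY ν hν)
        (hneY _ hν2))
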